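/- arXiv:2304.12065 — 2 statements merged into one kernel-verified Lean document; each statement's English description precedes it below -/
import Mathlib

section
/- For any $m \geq 2$ and convex bodies $A, B_1,\dots,B_m$ in $\mathbb{R}^n$: $|A|^{m-1} |A + B_1 + \cdots + B_m| \leq \left(1 + \frac{1}{m-1}\right)^{(m-1)n} \prod_{k=1}^m |A + B_k| \leq e^n \prod_{k=1}^m |A+B_k|$. -/
open scoped Pointwise
open MeasureTheory

/-- A convex body in `ℝⁿ`: a compact convex set with nonempty interior. -/
def IsConvexBody {n : ℕ} (K : Set (EuclideanSpace ℝ (Fin n))) : Prop :=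
  Convex ℝ K ∧ IsCompact K ∧ (interior K).Nonempty

set_option linter.unusedSectionVars false

section MatrixIneq
open Matrix
open scoped MatrixOrder

variable {ι : Type*} [Fintype ι] [DecidableEq ι]

lemma exists_sqrt_psd {H : Matrix ι ι ℝ} (hH : H.PosSemidef) :
    ∃ W : Matrix ι ι ℝ, Wᴴ = W ∧ W * W = H := by
  refine ⟨CFC.sqrt H, ?_, ?_⟩
  · exact (CFC.sqrt_nonneg H).posSemidef.1
  · exact CFC.sqrt_mul_sqrt_self H hH.nonneg

lemma psd_conj {W C : Matrix ι ι ℝ} (hW : Wᴴ = W) (hC : C.PosSemidef) :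
    (W * C * W).PosSemidef := by
  have := hC.mul_mul_conjTranspose_same W
  rwa [hW] at this

lemma one_le_det_one_add {P : Matrix ι ι ℝ} (hP : P.PosSemidef) : 1 ≤ (1 + P).det := by
  have h1 : (1 + P) = (hP.1.eigenvectorUnitary : Matrix ι ι ℝ) *
      diagonal (fun i => 1 + hP.1.eigenvalues i) *
        (star (hP.1.eigenvectorUnitary : Matrix ι ι ℝ)) := by
    have h2 := hP.1.spectral_theorem
    have h3 : diagonal (fun i => 1 + hP.1.eigenvalues i) =
        (1 : Matrix ι ι ℝ) + diagonal (RCLike.ofReal ∘ hP.1.eigenvalues) := by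
      rw [← diagonal_one, diagonal_add]; rfl
    rw [h3, mul_add, add_mul, mul_one]
    have h4 : (hP.1.eigenvectorUnitary : Matrix ι ι ℝ) *
      star (hP.1.eigenvectorUnitary : Matrix ι ι ℝ) = 1 := by simp
    rw [h4]
    congr 1
  have h4 : (star (hP.1.eigenvectorUnitary : Matrix ι ι ℝ)).det *
      (hP.1.eigenvectorUnitary : Matrix ι ι ℝ).det = 1 := by
    rw [← det_mul]; simp
  rw [h1, det_mul, det_mul, det_diagonal]
  have : ∀ a b c : ℝ, a * b = 1 → b * c * a = c := by
    intro a b c h; calc b * c * a = (a * b) * c := by ring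
      _ = c := by rw [h, one_mul]
  rw [this _ _ _ h4]
  have hnn : ∀ i, 1 ≤ 1 + hP.1.eigenvalues i := fun i => by
    have := hP.eigenvalues_nonneg i
    linarith
  exact Finset.prod_induction _ (fun x : ℝ => 1 ≤ x) (fun a b ha hb => one_le_mul_of_one_le_of_one_le ha hb) le_rfl
    (fun i _ => hnn i)

lemma isUnit_det_of_sq {W H : Matrix ι ι ℝ} (h : W * W = H) (hd : H.det ≠ 0) : IsUnit W.det := by
  rw [isUnit_iff_ne_zero]; intro h0; apply hd; rw [← h, det_mul, h0, zero_mul]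

/-- factor out the square root of a definite matrix -/
lemma det_add_factor {W : Matrix ι ι ℝ} (hW : IsUnit W.det) (C : Matrix ι ι ℝ) :
    (W * W + C).det = (W * W).det * (1 + W⁻¹ * C * W⁻¹).det := by
  have : W * W + C = W * (1 + W⁻¹ * C * W⁻¹) * W := by
    rw [mul_add, add_mul, mul_one]
    congr 1
    simp only [← mul_assoc]
    rw [mul_nonsing_inv _ hW, one_mul, mul_assoc, nonsing_inv_mul _ hW, mul_one]
  rw [this, det_mul, det_mul, det_mul]; ring

lemma det_mono_psd {Y D : Matrix ι ι ℝ} (hY : Y.PosSemidef) (hD : D.PosSemidef)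
    (hd : Y.det ≠ 0) : Y.det ≤ (Y + D).det := by
  obtain ⟨W, hW, hWW⟩ := exists_sqrt_psd hY
  have hu := isUnit_det_of_sq hWW hd
  rw [← hWW, det_add_factor hu]
  have hWi : (W⁻¹)ᴴ = W⁻¹ := by rw [conjTranspose_nonsing_inv, hW]
  have h1 := one_le_det_one_add (psd_conj hWi hD)
  have h2 : 0 ≤ (W * W).det := by rw [det_mul]; exact mul_self_nonneg _
  nlinarith

lemma det_one_add_add {C D : Matrix ι ι ℝ} (hC : C.PosSemidef) (hD : D.PosSemidef) :
    (1 + C + D).det ≤ (1 + C).det * (1 + D).det := by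
  obtain ⟨S, hS, hSS⟩ := exists_sqrt_psd hD
  have hX : (1 + C).PosSemidef := PosSemidef.one.add hC
  have hXd : 1 ≤ (1 + C).det := one_le_det_one_add hC
  have hXu : IsUnit (1 + C).det := isUnit_iff_ne_zero.2 (by linarith)
  set X := 1 + C with hXdef
  have hXi : (X⁻¹).PosSemidef := hX.inv
  have e1 : X + D = X * (1 + X⁻¹ * S * S) := by
    rw [mul_add, mul_one, mul_assoc X⁻¹, ← mul_assoc, mul_nonsing_inv _ hXu, one_mul, hSS]
  have e2 : (1 + X⁻¹ * S * S).det = (1 + S * X⁻¹ * S).det := by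
    rw [det_one_add_mul_comm, ← mul_assoc]
  have e3 : (1 - X⁻¹) = X⁻¹ * (C + C * C) * X⁻¹ := by
    have : C + C * C = X * X - X := by rw [hXdef]; noncomm_ring
    rw [this, mul_sub, sub_mul, ← mul_assoc, nonsing_inv_mul _ hXu, one_mul, one_mul,
      mul_nonsing_inv _ hXu]
  have hCC : (C * C).PosSemidef := by
    have := posSemidef_conjTranspose_mul_self C
    rwa [hC.1.eq] at this
  have e4 : (1 - X⁻¹).PosSemidef := by
    rw [e3]; exact psd_conj hXi.1 (hC.add hCC)
  have hP := psd_conj hS hXi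
  have h5 := det_mono_psd (PosSemidef.one.add hP) (psd_conj hS e4)
    (by have := one_le_det_one_add hP; linarith)
  have e6 : 1 + S * X⁻¹ * S + S * (1 - X⁻¹) * S = 1 + D := by
    rw [← hSS]; noncomm_ring
  rw [e6] at h5
  rw [e1, det_mul, e2]
  exact mul_le_mul_of_nonneg_left h5 (by linarith)

lemma det_one_add_sum {κ : Type*} (s : Finset κ) (C : κ → Matrix ι ι ℝ)
    (hC : ∀ k, (C k).PosSemidef) :
    (1 + ∑ k ∈ s, C k).det ≤ ∏ k ∈ s, (1 + C k).det := by
  classical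
  induction s using Finset.induction_on with
  | empty => simp
  | insert a s ha ih =>
    rw [Finset.sum_insert ha, Finset.prod_insert ha, ← add_assoc]
    have h0 := one_le_det_one_add (hC a)
    exact (det_one_add_add (hC a) (posSemidef_sum s (fun k _ => hC k))).trans
      (mul_le_mul_of_nonneg_left ih (by linarith))

lemma det_sum_le_one {κ : Type*} (s : Finset κ) (C : κ → Matrix ι ι ℝ)
    (hC : ∀ k, (C k).PosSemidef) :
    (∑ k ∈ s, C k).det ≤ ∏ k ∈ s, (1 + C k).det := by
  have hS : (∑ k ∈ s, C k).PosSemidef := posSemidef_sum s (fun k _ => hC k)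
  refine le_trans ?_ (det_one_add_sum s C hC)
  by_cases h0 : (∑ k ∈ s, C k).det = 0
  · rw [h0]; have := one_le_det_one_add hS; linarith
  · rw [add_comm]; exact det_mono_psd hS PosSemidef.one h0

lemma det_sum_le {m : ℕ} (hm : 1 ≤ m) (H : Matrix ι ι ℝ) (C : Fin m → Matrix ι ι ℝ)
    (hH : H.PosSemidef) (hd : H.det ≠ 0) (hC : ∀ k, (C k).PosSemidef) :
    H.det ^ (m - 1) * (∑ k, C k).det ≤ ∏ k, (H + C k).det := by
  obtain ⟨W, hW, hWW⟩ := exists_sqrt_psd hH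
  have hu := isUnit_det_of_sq hWW hd
  have hWi : (W⁻¹)ᴴ = W⁻¹ := by rw [conjTranspose_nonsing_inv, hW]
  have h1 := det_sum_le_one Finset.univ (fun k => W⁻¹ * C k * W⁻¹) (fun k => psd_conj hWi (hC k))
  have h2 : ∀ k, (H + C k).det = H.det * (1 + W⁻¹ * C k * W⁻¹).det := fun k => by
    rw [← hWW]; exact det_add_factor hu _
  simp_rw [h2]
  rw [Finset.prod_mul_distrib, Finset.prod_const, Finset.card_univ, Fintype.card_fin]
  have h3 : (∑ k, C k).det = H.det * (∑ k, W⁻¹ * C k * W⁻¹).det := by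
    rw [← Finset.sum_mul, ← Finset.mul_sum, ← hWW, det_mul, det_mul, det_mul, det_nonsing_inv]
    have := Ring.mul_inverse_cancel _ hu
    calc (∑ k, C k).det = (W.det * Ring.inverse W.det) * (W.det * Ring.inverse W.det) *
        (∑ k, C k).det := by rw [this]; ring
      _ = _ := by ring
  rw [h3, ← mul_assoc, ← pow_succ, Nat.sub_add_cancel hm]
  exact mul_le_mul_of_nonneg_left h1 (pow_nonneg hH.det_nonneg _)

lemma det_key {m : ℕ} (hm : 1 ≤ m) (H Q : Matrix ι ι ℝ) (D : Fin m → Matrix ι ι ℝ)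
    (hHQ : H + Q = 1) (hH : H.PosSemidef) (hQ : Q.PosSemidef) (hHd : H.det ≠ 0) (hQd : Q.det ≠ 0)
    (hD : ∀ k, (D k).PosSemidef) :
    H.det ^ (m - 1) * ((∑ k, D k).det * Q.det) ≤ ∏ k, (H + D k * Q).det := by
  obtain ⟨R, hR, hRR⟩ := exists_sqrt_psd hQ
  have hu := isUnit_det_of_sq hRR hQd
  have h1 := det_sum_le hm H (fun k => R * D k * R) hH hHd (fun k => psd_conj hR (hD k))
  have h2 : (∑ k, R * D k * R).det = (∑ k, D k).det * Q.det := by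
    rw [← Finset.sum_mul, ← Finset.mul_sum, det_mul, det_mul, ← hRR, det_mul]; ring
  have hcomm : R * H = H * R := by
    have : H = 1 - R * R := by rw [hRR, ← hHQ]; simp
    rw [this]; noncomm_ring
  have h3 : ∀ k, (H + R * D k * R).det = (H + D k * Q).det := fun k => by
    have e : (H + R * D k * R) * R = R * (H + D k * Q) := by
      rw [add_mul, mul_add, hcomm, ← hRR]; noncomm_ring
    have e2 := congrArg det e
    rw [det_mul, det_mul, mul_comm] at e2
    exact mul_left_cancel₀ hu.ne_zero e2
  rw [h2] at h1
  simpa only [h3] using h1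

end MatrixIneq

section Prox
variable {E : Type*} [NormedAddCommGroup E] [InnerProductSpace ℝ E]

/-- Firmly nonexpansive maps. -/
def FNE (Y : E → E) : Prop := ∀ r r', ‖Y r - Y r'‖ ^ 2 ≤ inner ℝ (Y r - Y r') (r - r')

lemma FNE.compl {Y : E → E} (h : FNE Y) : FNE (fun r => r - Y r) := by
  intro r r'
  have h1 := h r r'
  have e : r - Y r - (r' - Y r') = (r - r') - (Y r - Y r') := by abel
  simp only [e]
  rw [← real_inner_self_eq_norm_sq] at *
  simp only [inner_sub_left (r - r') (Y r - Y r'), inner_sub_right _ (r - r') (Y r - Y r')]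
  rw [real_inner_comm (Y r - Y r') (r - r')] at *
  linarith

lemma FNE.lip {Y : E → E} (h : FNE Y) : LipschitzWith 1 Y := by
  refine LipschitzWith.of_dist_le_mul fun r r' => ?_
  rw [dist_eq_norm, dist_eq_norm, NNReal.coe_one, one_mul]
  have h1 := (h r r').trans (real_inner_le_norm _ _)
  by_contra hc
  push Not at hc
  nlinarith [norm_nonneg (Y r - Y r'), norm_nonneg (r - r')]

lemma FNE.segment {Y : E → E} (h : FNE Y) {r r' : E} (he : Y r = Y r') (t : ℝ)
    (h0 : 0 ≤ t) (h1 : t ≤ 1) : Y (r + t • (r' - r)) = Y r := by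
  rcases h0.eq_or_lt with rfl | h0
  · simp
  rcases h1.eq_or_lt with rfl | h1
  · simp [he]
  have a1 := h (r + t • (r' - r)) r
  have a2 := h (r + t • (r' - r)) r'
  rw [← he] at a2
  set w := Y (r + t • (r' - r)) - Y r with hw
  have e1 : r + t • (r' - r) - r = t • (r' - r) := by abel
  have e2 : r + t • (r' - r) - r' = (-(1 - t)) • (r' - r) := by module
  rw [e1, inner_smul_right] at a1
  rw [e2, inner_smul_right] at a2
  have : ‖w‖ ^ 2 ≤ 0 := by
    have hn := sq_nonneg ‖w‖
    nlinarith
  have hw0 : w = 0 := by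
    rw [← norm_eq_zero]; exact pow_eq_zero_iff (two_ne_zero) |>.1 (le_antisymm this (sq_nonneg _))
  exact sub_eq_zero.1 hw0

lemma FNE.deriv_ker {Y : E → E} (h : FNE Y) {r r' : E} (he : Y r = Y r') {D : E →L[ℝ] E}
    (hD : HasFDerivAt Y D r) : D (r' - r) = 0 := by
  have h1 : HasDerivAt (fun t : ℝ => Y (r + t • (r' - r))) (D (r' - r)) 0 := by
    have h2 : HasDerivAt (fun t : ℝ => r + t • (r' - r)) (r' - r) 0 := by
      simpa using ((hasDerivAt_id (0:ℝ)).smul_const (r' - r)).const_add r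
    have h3 : HasFDerivAt Y D (r + (0:ℝ) • (r' - r)) := by simpa using hD
    exact h3.comp_hasDerivAt (0:ℝ) h2
  have h4 : HasDerivWithinAt (fun t : ℝ => Y (r + t • (r' - r))) 0 (Set.Icc 0 1) 0 := by
    refine (hasDerivWithinAt_const (0:ℝ) (Set.Icc (0:ℝ) 1) (Y r)).congr (fun t ht => h.segment he t ht.1 ht.2) (by simp)
  exact (uniqueDiffOn_Icc (zero_lt_one' ℝ) 0 (by simp)).eq_deriv _ h1.hasDerivWithinAt h4

lemma FNE.deriv_nonneg {Y : E → E} (h : FNE Y) {r : E} {D : E →L[ℝ] E}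
    (hD : HasFDerivAt Y D r) (v : E) : 0 ≤ inner ℝ (D v) v := by
  have h1 : HasDerivAt (fun t : ℝ => inner ℝ (Y (r + t • v)) v) (inner ℝ (D v) v) 0 := by
    have h2 : HasDerivAt (fun t : ℝ => r + t • v) v 0 := by
      simpa using ((hasDerivAt_id (0:ℝ)).smul_const v).const_add r
    have h3 : HasFDerivAt Y D (r + (0:ℝ) • v) := by simpa using hD
    have h4 := h3.comp_hasDerivAt (0:ℝ) h2
    simpa using h4.inner ℝ (hasDerivAt_const (0:ℝ) v)
  have hm : Monotone (fun t : ℝ => inner ℝ (Y (r + t • v)) v) := by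
    intro s t hst
    rcases hst.eq_or_lt with rfl | hst
    · exact le_rfl
    have h5 := (sq_nonneg _).trans (h (r + t • v) (r + s • v))
    have e : r + t • v - (r + s • v) = (t - s) • v := by module
    rw [e, inner_smul_right, inner_sub_left] at h5
    have := (mul_nonneg_iff_of_pos_left (by linarith : 0 < t - s)).1 h5
    simpa using this
  rw [← h1.deriv]
  exact hm.deriv_nonneg

structure IsProx (C : Set E) (g : E → ℝ) (Y : E → E) : Prop where
  mem : ∀ r, Y r ∈ C
  vi : ∀ r, ∀ z ∈ C, g (Y r) + inner ℝ (r - Y r) (z - Y r) ≤ g z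

lemma exists_isProx {C : Set E} (hC : Convex ℝ C) (hK : IsCompact C) (hne : C.Nonempty)
    {g : E → ℝ} (hg : ConvexOn ℝ C g) (hgc : ContinuousOn g C) : ∃ Y, IsProx C g Y := by
  have key : ∀ r : E, ∃ y ∈ C, ∀ z ∈ C, g y + inner ℝ (r - y) (z - y) ≤ g z := by
    intro r
    obtain ⟨y, hy, hmin⟩ := hK.exists_isMinOn hne
      (f := fun y => g y + ‖y - r‖ ^ 2 / 2) (hgc.add (by fun_prop))
    refine ⟨y, hy, fun z hz => ?_⟩
    have hall : ∀ t : ℝ, 0 < t → t ≤ 1 → 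
        g y + inner ℝ (r - y) (z - y) ≤ g z + t * (‖z - y‖ ^ 2 / 2) := by
      intro t h0 h1
      have hmem : (1 - t) • y + t • z ∈ C := hC hy hz (by linarith) h0.le (by ring)
      have a1 := hg.2 hy hz (by linarith : 0 ≤ 1 - t) h0.le (by ring)
      have a2 := hmin hmem
      simp only [Set.mem_ofPred_eq] at a2
      have e : (1 - t) • y + t • z - r = (y - r) + t • (z - y) := by module
      rw [e, norm_add_sq_real, norm_smul, inner_smul_right] at a2
      have e2 : inner ℝ (y - r) (z - y) = - inner ℝ (r - y) (z - y) := by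
        rw [← inner_neg_left, neg_sub]
      rw [e2, Real.norm_of_nonneg h0.le] at a2
      simp only [smul_eq_mul] at a1
      have : t * (g y + inner ℝ (r - y) (z - y)) ≤ t * (g z + t * (‖z - y‖ ^ 2 / 2)) := by
        nlinarith
      exact le_of_mul_le_mul_left this h0
    refine le_of_forall_pos_le_add fun ε hε => ?_
    set c := ‖z - y‖ ^ 2 / 2 with hc
    have hc0 : 0 ≤ c := by positivity
    have h3 := hall (min 1 (ε / (c + 1))) (by positivity) (min_le_left _ _)
    have h4 : min 1 (ε / (c + 1)) * c ≤ ε := by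
      calc min 1 (ε / (c + 1)) * c ≤ (ε / (c + 1)) * c := by gcongr; exact min_le_right _ _
        _ ≤ (ε / (c + 1)) * (c + 1) := by gcongr; linarith
        _ = ε := by field_simp
    linarith
  choose Y h1 h2 using key
  exact ⟨Y, h1, h2⟩

lemma IsProx.fne {C : Set E} {g : E → ℝ} {Y : E → E} (h : IsProx C g Y) : FNE Y := by
  intro r r'
  have h1 := h.vi r _ (h.mem r')
  have h2 := h.vi r' _ (h.mem r)
  rw [← real_inner_self_eq_norm_sq]
  simp only [inner_sub_left, inner_sub_right] at *
  simp only [real_inner_comm] at *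
  have := real_inner_comm (Y r) (Y r')
  have := real_inner_comm (Y r) r
  have := real_inner_comm (Y r) r'
  have := real_inner_comm (Y r') r
  have := real_inner_comm (Y r') r'
  linarith

/-- the potential of a prox map -/
noncomputable def proxPot (g : E → ℝ) (Y : E → E) (r : E) : ℝ :=
  inner ℝ r (Y r) - g (Y r) - ‖Y r‖ ^ 2 / 2

lemma IsProx.pot_ge {C : Set E} {g : E → ℝ} {Y : E → E} (h : IsProx C g Y) (r z : E) (hz : z ∈ C) :
    inner ℝ r z - g z - ‖z‖ ^ 2 / 2 ≤ proxPot g Y r := by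
  have h1 := h.vi r z hz
  have h2 : 0 ≤ ‖z - Y r‖ ^ 2 := sq_nonneg _
  unfold proxPot
  rw [← real_inner_self_eq_norm_sq] at *
  rw [← real_inner_self_eq_norm_sq]
  simp only [inner_sub_left, inner_sub_right] at *
  have := real_inner_comm (Y r) z
  linarith

lemma IsProx.hasFDerivAt {C : Set E} {g : E → ℝ} {Y : E → E} (h : IsProx C g Y) (r : E) :
    HasFDerivAt (proxPot g Y) (innerSL ℝ (Y r)) r := by
  rw [hasFDerivAt_iff_isLittleO_nhds_zero]
  have hb : ∀ v : E, ‖proxPot g Y (r + v) - proxPot g Y r - innerSL ℝ (Y r) v‖ ≤ ‖v‖ ^ 2 := by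
    intro v
    have h1 := h.pot_ge (r + v) (Y r) (h.mem r)
    have h2 := h.pot_ge r (Y (r + v)) (h.mem _)
    have e1 : proxPot g Y r = inner ℝ r (Y r) - g (Y r) - ‖Y r‖ ^ 2 / 2 := rfl
    have e2 : proxPot g Y (r + v) = inner ℝ (r + v) (Y (r + v)) - g (Y (r + v)) - ‖Y (r + v)‖ ^ 2 / 2 := rfl
    have h3 : inner ℝ (Y (r + v) - Y r) v ≤ ‖v‖ ^ 2 := by
      refine (real_inner_le_norm _ _).trans ?_
      have := h.fne.lip.dist_le_mul (r + v) r
      rw [dist_eq_norm, dist_eq_norm] at this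
      simp at this
      nlinarith [norm_nonneg v]
    rw [inner_add_left] at h1 e2
    rw [inner_sub_left] at h3
    rw [innerSL_apply_apply, Real.norm_eq_abs, abs_le]
    have := real_inner_comm (Y r) v
    have := real_inner_comm (Y (r + v)) v
    constructor <;> nlinarith [sq_nonneg ‖v‖]
  refine Asymptotics.IsBigO.trans_isLittleO (g := fun v : E => ‖v‖ ^ 2) ?_ ?_
  · exact Asymptotics.IsBigO.of_bound 1 (Filter.Eventually.of_forall fun v => by
      simpa using hb v)
  · exact Asymptotics.isLittleO_norm_pow_id one_lt_two

lemma IsProx.symm {C : Set E} {g : E → ℝ} {Y : E → E} (h : IsProx C g Y) {r : E} {D : E →L[ℝ] E}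
    (hD : HasFDerivAt Y D r) (v w : E) : inner ℝ (D v) w = inner ℝ (D w) v := by
  have h1 : HasFDerivAt (fun r => innerSL ℝ (Y r)) ((innerSL ℝ).comp D) r :=
    ((innerSL ℝ : E →L[ℝ] E →L[ℝ] ℝ).hasFDerivAt (x := Y r)).comp r hD
  have := second_derivative_symmetric (𝕜 := ℝ) (fun y => h.hasFDerivAt y) h1 v w
  simpa using this

variable [FiniteDimensional ℝ E]

lemma IsProx.isPositive {C : Set E} {g : E → ℝ} {Y : E → E} (h : IsProx C g Y) {r : E}
    {D : E →L[ℝ] E} (hD : HasFDerivAt Y D r) : (D : E →ₗ[ℝ] E).IsPositive := by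
  refine ⟨fun v w => ?_, fun v => ?_⟩
  · have := h.symm hD v w
    simpa [real_inner_comm] using this
  · simpa using h.fne.deriv_nonneg hD v

lemma IsProx.isPositive_compl {C : Set E} {g : E → ℝ} {Y : E → E} (h : IsProx C g Y) {r : E}
    {D : E →L[ℝ] E} (hD : HasFDerivAt Y D r) :
    ((ContinuousLinearMap.id ℝ E - D : E →L[ℝ] E) : E →ₗ[ℝ] E).IsPositive := by
  refine ⟨fun v w => ?_, fun v => ?_⟩
  · have := h.symm hD v w
    simp [inner_sub_left, inner_sub_right, this, real_inner_comm]
  · simpa using h.fne.compl.deriv_nonneg ((hasFDerivAt_id r).sub hD) v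

lemma clm_det_key {m : ℕ} (hm : 1 ≤ m) (H Q : E →L[ℝ] E) (D : Fin m → E →L[ℝ] E)
    (hHQ : H + Q = ContinuousLinearMap.id ℝ E) (hH : (H : E →ₗ[ℝ] E).IsPositive)
    (hQ : (Q : E →ₗ[ℝ] E).IsPositive) (hHd : H.det ≠ 0) (hQd : Q.det ≠ 0)
    (hD : ∀ k, (D k : E →ₗ[ℝ] E).IsPositive) :
    |H.det| ^ (m - 1) * (|(∑ k, D k).det| * |Q.det|) ≤ ∏ k, |(H + (D k).comp Q).det| := by
  set b := stdOrthonormalBasis ℝ E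
  let M : (E →L[ℝ] E) → Matrix _ _ ℝ := fun T => LinearMap.toMatrix b.toBasis b.toBasis (T : E →ₗ[ℝ] E)
  have hdet : ∀ T, (M T).det = T.det := fun T => LinearMap.det_toMatrix b.toBasis (T : E →ₗ[ℝ] E)
  have hpos : ∀ T : E →L[ℝ] E, (T : E →ₗ[ℝ] E).IsPositive → (M T).PosSemidef := fun T hT =>
    (LinearMap.posSemidef_toMatrix_iff b).2 hT
  have hadd : ∀ S T, M (S + T) = M S + M T := fun S T => by simp [M]
  have hmul : ∀ S T, M (S.comp T) = M S * M T := fun S T => by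
    simp only [M]; rw [← LinearMap.toMatrix_comp b.toBasis b.toBasis b.toBasis]; rfl
  have hsum : M (∑ k, D k) = ∑ k, M (D k) := by simp [M, map_sum]
  have h1 := det_key hm (M H) (M Q) (fun k => M (D k))
    (by rw [← hadd, hHQ]; exact LinearMap.toMatrix_id _) (hpos _ hH) (hpos _ hQ) (by rwa [hdet])
    (by rwa [hdet]) (fun k => hpos _ (hD k))
  rw [← hsum] at h1
  simp only [← hmul, ← hadd, hdet] at h1
  have hnn : ∀ T : E →L[ℝ] E, (T : E →ₗ[ℝ] E).IsPositive → |T.det| = T.det := fun T hT => by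
    rw [abs_of_nonneg]; rw [← hdet]; exact (hpos T hT).det_nonneg
  have hS : |(∑ k, D k).det| = (∑ k, D k).det := by
    rw [abs_of_nonneg]; rw [← hdet, hsum]
    exact (Matrix.posSemidef_sum _ (fun k _ => hpos _ (hD k))).det_nonneg
  rw [hnn H hH, hnn Q hQ, hS, ← Finset.abs_prod]
  exact h1.trans (le_abs_self _)

end Prox

section Brenier
variable {E : Type*} [NormedAddCommGroup E] [InnerProductSpace ℝ E]

/-- Legendre conjugate of a function on a set. -/
noncomputable def cj (A : Set E) (f : A → ℝ) (x : E) : ℝ := ⨆ z : A, (inner ℝ x (z : E) - f z)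

lemma cj_bdd {A : Set E} (hA : IsCompact A) {f : A → ℝ} (hf : Continuous f) (x : E) :
    BddAbove (Set.range fun z : A => (inner ℝ x (z : E) - f z)) := by
  have := isCompact_iff_compactSpace.1 hA
  exact (isCompact_range (by fun_prop)).bddAbove

lemma le_cj {A : Set E} (hA : IsCompact A) {f : A → ℝ} (hf : Continuous f) (x : E) (z : A) :
    inner ℝ x (z : E) - f z ≤ cj A f x := le_ciSup (cj_bdd hA hf x) z

lemma cj_attained {A : Set E} (hA : IsCompact A) (hne : A.Nonempty) {f : A → ℝ}
    (hf : Continuous f) (x : E) : ∃ z : A, cj A f x = inner ℝ x (z : E) - f z := by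
  have := isCompact_iff_compactSpace.1 hA
  have := hne.to_subtype
  obtain ⟨z, hz⟩ := IsCompact.exists_sSup_image_eq (isCompact_univ (X := A)) Set.univ_nonempty
    (f := fun z : A => (inner ℝ x (z : E) - f z)) (by fun_prop)
  refine ⟨z, ?_⟩
  rw [← hz.2, Set.image_univ]; rfl

lemma cj_le {A : Set E} (hne : A.Nonempty) {f : A → ℝ} {x : E} {c : ℝ}
    (h : ∀ z : A, inner ℝ x (z : E) - f z ≤ c) : cj A f x ≤ c := by
  have := hne.to_subtype
  exact ciSup_le h

lemma cj_lip {A : Set E} (hA : IsCompact A) (hne : A.Nonempty) {f : A → ℝ}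
    (hf : Continuous f) {R : NNReal} (hR : ∀ z ∈ A, ‖z‖ ≤ R) : LipschitzWith R (cj A f) := by
  refine LipschitzWith.of_le_add_mul R fun x x' => cj_le hne fun z => ?_
  have h1 := le_cj hA hf x' z
  have h2 : inner ℝ (x - x') (z : E) ≤ R * dist x x' := by
    refine (real_inner_le_norm _ _).trans ?_
    rw [dist_eq_norm, mul_comm]
    exact mul_le_mul_of_nonneg_right (hR z z.2) (norm_nonneg _)
  rw [inner_sub_left] at h2
  linarith

lemma cj_convex {A : Set E} (hA : IsCompact A) (hne : A.Nonempty) {f : A → ℝ}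
    (hf : Continuous f) : ConvexOn ℝ Set.univ (cj A f) := by
  refine ⟨convex_univ, fun x _ y _ a b ha hb hab => cj_le hne fun z => ?_⟩
  have h1 := mul_le_mul_of_nonneg_left (le_cj hA hf x z) ha
  have h2 := mul_le_mul_of_nonneg_left (le_cj hA hf y z) hb
  rw [inner_add_left, real_inner_smul_left, real_inner_smul_left]
  simp only [smul_eq_mul]
  have : f z = a * f z + b * f z := by rw [← add_mul, hab, one_mul]
  linarith

lemma cj_sub_le {A : Set E} (hA : IsCompact A) (hne : A.Nonempty) {f g : A → ℝ}
    (hg : Continuous g) {c : ℝ} (h : ∀ z, g z ≤ f z + c) (x : E) :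
    cj A f x ≤ cj A g x + c := by
  refine cj_le hne fun z => ?_
  have := le_cj hA hg x z
  have := h z
  linarith

lemma exists_bound {A : Set E} (hA : IsCompact A) : ∃ R : NNReal, ∀ z ∈ A, ‖z‖ ≤ R := by
  obtain ⟨R, hR⟩ := hA.isBounded.exists_norm_le
  exact ⟨R.toNNReal, fun z hz => (hR z hz).trans (Real.le_coe_toNNReal R)⟩

variable [FiniteDimensional ℝ E] [MeasurableSpace E] [BorelSpace E]

/-- Kantorovich dual functional -/
noncomputable def dualJ (A : Set E) (ν : Measure A) (μ : Measure E) (u : A → ℝ) : ℝ :=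
  ν.real Set.univ * ∫ p, cj A u p ∂μ + μ.real Set.univ * ∫ y, u y ∂ν

lemma cont_integrable {K : Set E} (hK : IsCompact K) (μ : Measure E) [IsFiniteMeasure μ]
    (hμK : μ Kᶜ = 0) {f : E → ℝ} (hf : Continuous f) : Integrable f μ := by
  have h1 : IntegrableOn f K μ := hf.continuousOn.integrableOn_compact hK
  have h2 : μ.restrict K = μ := Measure.restrict_eq_self_of_ae_mem (by
    rw [ae_iff]; exact hμK)
  rwa [IntegrableOn, h2] at h1

lemma cont_integrable' {A : Set E} (hA : IsCompact A) (ν : Measure A) [IsFiniteMeasure ν]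
    {f : A → ℝ} (hf : Continuous f) : Integrable f ν := by
  have := isCompact_iff_compactSpace.1 hA
  have h1 : IntegrableOn f Set.univ ν := hf.continuousOn.integrableOn_compact isCompact_univ
  rwa [integrableOn_univ] at h1

lemma dualJ_le {A K : Set E} (hA : IsCompact A) (hne : A.Nonempty) (hK : IsCompact K)
    (ν : Measure A) [IsFiniteMeasure ν]
    (μ : Measure E) [IsFiniteMeasure μ] (hμK : μ Kᶜ = 0) {u v : A → ℝ} (hu : Continuous u)
    (hv : Continuous v) {c d : ℝ} (h1 : ∀ p ∈ K, cj A u p ≤ cj A v p + c) (h2 : ∀ z, u z ≤ v z + d) :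
    dualJ A ν μ u ≤ dualJ A ν μ v + (ν.real Set.univ * μ.real Set.univ) * (c + d) := by
  obtain ⟨R, hR⟩ := exists_bound hA
  have i1 := cont_integrable hK μ hμK (cj_lip hA hne hu hR).continuous
  have i2 := cont_integrable hK μ hμK (cj_lip hA hne hv hR).continuous
  have i3 := cont_integrable' hA ν hu
  have i4 := cont_integrable' hA ν hv
  have a1 : ∫ p, cj A u p ∂μ ≤ ∫ p, cj A v p ∂μ + μ.real Set.univ * c := by
    have := integral_mono_ae i1 (i2.add (integrable_const c)) (by
      have : ∀ᵐ p ∂μ, p ∈ K := by rw [ae_iff]; exact hμK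
      filter_upwards [this] with p hp using h1 p hp)
    rw [integral_add' i2 (integrable_const c)] at this
    simpa using this
  have a2 : ∫ p, u p ∂ν ≤ ∫ p, v p ∂ν + ν.real Set.univ * d := by
    have := integral_mono i3 (i4.add (integrable_const d)) h2
    rw [integral_add' i4 (integrable_const d)] at this
    simpa using this
  unfold dualJ
  have b1 := mul_le_mul_of_nonneg_left a1 (measureReal_nonneg (μ := ν) (s := Set.univ))
  have b2 := mul_le_mul_of_nonneg_left a2 (measureReal_nonneg (μ := μ) (s := Set.univ))
  linarith

lemma exists_dual_min {A K : Set E} (hA : IsCompact A) (hne : A.Nonempty) (hK : IsCompact K)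
    (hKne : K.Nonempty) (ν : Measure A) [IsFiniteMeasure ν]
    (μ : Measure E) [IsFiniteMeasure μ] (hμK : μ Kᶜ = 0) :
    ∃ U : E → ℝ, Continuous U ∧ ConvexOn ℝ Set.univ U ∧ ∀ v : A → ℝ, Continuous v →
      dualJ A ν μ (fun y => U y) ≤ dualJ A ν μ v := by
  have := isCompact_iff_compactSpace.1 hA
  obtain ⟨R, hR⟩ := exists_bound hA
  obtain ⟨L, hL⟩ := exists_bound hK
  obtain ⟨y0, hy0⟩ := hne
  have hne : A.Nonempty := ⟨y0, hy0⟩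
  -- the double conjugate
  let dc : (A → ℝ) → E → ℝ := fun u => cj K (fun p : K => cj A u p)
  have hcc : ∀ u : A → ℝ, Continuous u → Continuous (fun p : K => cj A u p) := fun u hu =>
    (cj_lip hA hne hu hR).continuous.comp continuous_subtype_val
  have hdl : ∀ u : A → ℝ, Continuous u → LipschitzWith L (dc u) := fun u hu =>
    cj_lip hK hKne (hcc u hu) hL
  have hdc : ∀ u : A → ℝ, Continuous u → Continuous (fun y : A => dc u y) := fun u hu =>
    (hdl u hu).continuous.comp continuous_subtype_val
  have hdJ : ∀ u : A → ℝ, Continuous u → dualJ A ν μ (fun y => dc u y) ≤ dualJ A ν μ u := by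
    intro u hu
    have := dualJ_le hA hne hK ν μ hμK (hdc u hu) hu (c := 0) (d := 0) ?_ ?_
    · simpa using this
    · intro p hp
      rw [add_zero]
      refine cj_le hne fun z => ?_
      have := le_cj hK (hcc u hu) z ⟨p, hp⟩
      simp only [dc]
      rw [real_inner_comm] at this
      simp only at this
      linarith
    · intro z
      rw [add_zero]
      refine cj_le hKne fun p => ?_
      have := le_cj hA hu p z
      rw [real_inner_comm]
      linarith
  let 𝒰 : Set (BoundedContinuousFunction A ℝ) :=
    {u | (∀ y y' : A, dist (u y) (u y') ≤ L * dist y y') ∧ u ⟨y0, hy0⟩ = 0}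
  have hcl : IsClosed 𝒰 := by
    apply IsClosed.and
    · simp only [Set.ofPred_forall]
      refine isClosed_iInter fun y => isClosed_iInter fun y' => ?_
      exact isClosed_le (by fun_prop) continuous_const
    · exact isClosed_eq (by fun_prop) continuous_const
  have hcomp : IsCompact 𝒰 := by
    refine BoundedContinuousFunction.arzela_ascoli₂ (Metric.closedBall 0 (L * (2 * R)))
      (isCompact_closedBall _ _) 𝒰 hcl ?_ ?_
    · intro f x hf
      have h1 := hf.1 x ⟨y0, hy0⟩
      rw [hf.2] at h1
      rw [Metric.mem_closedBall]
      refine h1.trans ?_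
      gcongr
      rw [Subtype.dist_eq, dist_eq_norm]
      have := norm_sub_le (x : E) y0
      have := hR _ x.2
      have := hR _ hy0
      linarith
    · apply (LipschitzWith.uniformEquicontinuous (fun f : 𝒰 => ((f : BoundedContinuousFunction A ℝ) : A → ℝ)) L
        (fun f => LipschitzWith.of_dist_le_mul f.2.1)).equicontinuous
  -- normalisation
  have hnorm : ∀ v : A → ℝ, Continuous v → ∃ w ∈ 𝒰, dualJ A ν μ w ≤ dualJ A ν μ v := by
    intro v hv
    let w0 : C(A, ℝ) := ⟨fun y => dc v y - dc v y0, (hdc v hv).sub continuous_const⟩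
    refine ⟨BoundedContinuousFunction.mkOfCompact w0, ⟨fun y y' => ?_, ?_⟩, ?_⟩
    · have := (hdl v hv).dist_le_mul y y'
      simpa [w0, Real.dist_eq, Subtype.dist_eq] using this
    · simp [w0]
    · refine le_trans ?_ (hdJ v hv)
      have := dualJ_le hA hne hK ν μ hμK w0.continuous (hdc v hv) (c := dc v y0) (d := - dc v y0) ?_ ?_
      · rw [add_neg_cancel, mul_zero, add_zero] at this
        exact this
      · intro p hp
        refine cj_sub_le hA hne (hdc v hv) (fun z => ?_) p
        simp [w0]
      · intro z; simp [w0, sub_eq_add_neg]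
  have hJc : Continuous (fun u : BoundedContinuousFunction A ℝ => dualJ A ν μ u) := by
    refine LipschitzWith.continuous (K := (2 * (ν.real Set.univ * μ.real Set.univ)).toNNReal) (LipschitzWith.of_le_add_mul _ fun u v => ?_)
    have hle : ∀ z, u z ≤ v z + dist u v := fun z => by
      have := BoundedContinuousFunction.dist_coe_le_dist (f := u) (g := v) z
      rw [Real.dist_eq] at this
      have := (abs_le.1 this).2
      linarith
    have hle' : ∀ z, v z ≤ u z + dist u v := fun z => by
      have := BoundedContinuousFunction.dist_coe_le_dist (f := u) (g := v) z
      rw [Real.dist_eq] at this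
      have := (abs_le.1 this).1
      linarith
    have := dualJ_le hA hne hK ν μ hμK u.continuous v.continuous (c := dist u v) (d := dist u v)
      (fun p _ => cj_sub_le hA hne v.continuous hle' p) hle
    rw [Real.coe_toNNReal _ (by positivity)]
    linarith
  obtain ⟨w, hw, -⟩ := hnorm (fun _ => 0) continuous_const
  obtain ⟨u0, hu0, hmin⟩ := hcomp.exists_isMinOn ⟨w, hw⟩ hJc.continuousOn
  refine ⟨dc u0, (hdl _ u0.continuous).continuous, cj_convex hK hKne (hcc _ u0.continuous), fun v hv => ?_⟩
  obtain ⟨w, hw, hwv⟩ := hnorm v hv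
  exact (hdJ _ u0.continuous).trans ((hmin hw).trans hwv)

end Brenier

section Brenier2
open Filter Topology
variable {E : Type*} [NormedAddCommGroup E] [InnerProductSpace ℝ E]
variable [FiniteDimensional ℝ E] [MeasurableSpace E] [BorelSpace E]

/-- gradient as a vector -/
noncomputable def gradv (α : E → ℝ) (p : E) : E := (InnerProductSpace.toDual ℝ E).symm (fderiv ℝ α p)

lemma measurable_gradv (α : E → ℝ) : Measurable (gradv α) :=
  (InnerProductSpace.toDual ℝ E).symm.continuous.measurable.comp (measurable_fderiv ℝ α)

lemma argmax_eq_gradv {A : Set E} (hA : IsCompact A) {u : A → ℝ} (hu : Continuous u) {p : E}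
    (hd : DifferentiableAt ℝ (cj A u) p) {y : A} (hy : cj A u p = inner ℝ p (y : E) - u y) :
    (y : E) = gradv (cj A u) p := by
  have h1 : HasFDerivAt (fun x => cj A u x - inner ℝ (y : E) x) (fderiv ℝ (cj A u) p - innerSL ℝ (y : E)) p :=
    hd.hasFDerivAt.sub (innerSL ℝ (y : E)).hasFDerivAt
  have h2 : IsLocalMin (fun x => cj A u x - inner ℝ (y : E) x) p := by
    refine Filter.Eventually.of_forall fun x => ?_
    simp only
    have := le_cj hA hu x y
    rw [hy, real_inner_comm p, real_inner_comm x]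
    linarith
  have h3 := sub_eq_zero.1 (h2.hasFDerivAt_eq_zero h1)
  rw [gradv, h3, LinearIsometryEquiv.eq_symm_apply]
  ext x; simp

lemma quot_tendsto {A : Set E} (hA : IsCompact A) (hne : A.Nonempty) {u h : A → ℝ}
    (hu : Continuous u) (hh : Continuous h) {C : ℝ} (hC : ∀ y, |h y| ≤ C) {p : E} {y : A}
    (hy : cj A u p = inner ℝ p (y : E) - u y)
    (huniq : ∀ z : A, cj A u p = inner ℝ p (z : E) - u z → z = y) (t : ℕ → ℝ) (ht : ∀ n, 0 < t n)
    (htl : Tendsto t atTop (𝓝 0)) :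
    Tendsto (fun n => (cj A (fun z => u z + t n * h z) p - cj A u p) / t n) atTop (𝓝 (- h y)) := by
  have := isCompact_iff_compactSpace.1 hA
  have hc : ∀ n, Continuous (fun z => u z + t n * h z) := fun n => by fun_prop
  have lower : ∀ n, - h y ≤ (cj A (fun z => u z + t n * h z) p - cj A u p) / t n := fun n => by
    rw [le_div_iff₀ (ht n)]
    have := le_cj hA (hc n) p y
    linarith
  rw [Metric.tendsto_atTop]
  intro ε hε
  have upper : ∃ N, ∀ n ≥ N, (cj A (fun z => u z + t n * h z) p - cj A u p) / t n ≤ - h y + ε / 2 := by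
    choose yn hyn using fun n => cj_attained hA hne (hc n) p
    have hub : ∀ n, (cj A (fun z => u z + t n * h z) p - cj A u p) / t n ≤ - h (yn n) := fun n => by
      rw [div_le_iff₀ (ht n), hyn n]
      have := le_cj hA hu p (yn n)
      linarith
    let W : Set A := {z | h z ≤ h y - ε / 2}
    have hW : IsCompact W := (isClosed_le hh continuous_const).isCompact
    rcases W.eq_empty_or_nonempty with hWe | hWne
    · refine ⟨0, fun n _ => (hub n).trans ?_⟩
      have : yn n ∉ W := by rw [hWe]; simp
      have : ¬ (h (yn n) ≤ h y - ε / 2) := this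
      linarith
    · obtain ⟨z, hz, hmin⟩ := hW.exists_isMinOn hWne
        (f := fun z : A => cj A u p - (inner ℝ p (z : E) - u z)) (by fun_prop)
      set η := cj A u p - (inner ℝ p (z : E) - u z) with hη
      have hη0 : 0 < η := by
        have h1 := le_cj hA hu p z
        rcases (sub_nonneg.2 h1).eq_or_lt with h2 | h2
        · exfalso
          have h3 := huniq z (by linarith)
          have h4 : h z ≤ h y - ε / 2 := hz
          rw [h3] at h4
          linarith
        · exact h2
      have hC0 : 0 ≤ C := (abs_nonneg _).trans (hC y)
      have h5 : ∀ᶠ n in atTop, t n < η / (2 * C + 1) := htl.eventually_lt_const (by positivity)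
      obtain ⟨N, hN⟩ := eventually_atTop.1 h5
      refine ⟨N, fun n hn => (hub n).trans ?_⟩
      have h6 := hN n hn
      rw [lt_div_iff₀ (by positivity)] at h6
      by_contra hcon
      have hmem : yn n ∈ W := by
        change h (yn n) ≤ h y - ε / 2
        linarith
      have h7 : η ≤ cj A u p - (inner ℝ p (yn n : E) - u (yn n)) := hmin hmem
      have h8 := le_cj hA (hc n) p y
      rw [hyn n] at h8
      have h9 := (abs_le.1 (hC (yn n))).1
      have h10 := (abs_le.1 (hC y)).2
      have h11 : t n * (h y - h (yn n)) ≤ t n * (2 * C) :=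
        mul_le_mul_of_nonneg_left (by linarith) (ht n).le
      have := ht n
      linarith
  obtain ⟨N, hN⟩ := upper
  refine ⟨N, fun n hn => ?_⟩
  rw [Real.dist_eq, abs_lt]
  have := lower n
  have := hN n hn
  constructor <;> linarith

theorem brenier {A K : Set E} (hA : IsCompact A) (hne : A.Nonempty) (hK : IsCompact K)
    (hKne : K.Nonempty) (vol : Measure E) [vol.IsAddHaarMeasure]
    (μ : Measure E) [IsFiniteMeasure μ] (hμK : μ Kᶜ = 0) (hac : μ ≪ vol) :
    ∃ u : E → ℝ, Continuous u ∧ ConvexOn ℝ Set.univ u ∧ ∃ T : E → E, Measurable T ∧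
      (vol A) • μ.map T = (μ Set.univ) • vol.restrict A ∧
      ∀ᵐ p ∂μ, ∀ y ∈ A, (∀ z ∈ A, u y + inner ℝ p (z - y) ≤ u z) → y = T p := by
  have hAm : MeasurableSet A := hA.measurableSet
  have hAfin : vol A < ⊤ := hA.measure_lt_top
  let ν : Measure A := vol.comap Subtype.val
  have hνu : ν Set.univ = vol A := by
    rw [Measure.comap_apply _ Subtype.val_injective (fun s hs => hAm.subtype_image hs) _ MeasurableSet.univ]
    simp
  have : IsFiniteMeasure ν := ⟨by rw [hνu]; exact hAfin⟩
  obtain ⟨U, hUc, hUcv, hmin⟩ := exists_dual_min hA hne hK hKne ν μ hμK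
  let u : A → ℝ := fun y => U y
  have hu : Continuous u := hUc.comp continuous_subtype_val
  obtain ⟨R, hR⟩ := exists_bound hA
  have hlip := cj_lip hA hne hu hR
  have hdiff : ∀ᵐ p ∂μ, DifferentiableAt ℝ (cj A u) p := hac.ae_le (hlip.ae_differentiableAt (μ := vol))
  refine ⟨U, hUc, hUcv, gradv (cj A u), measurable_gradv _, ?_, ?_⟩
  swap
  · filter_upwards [hdiff] with p hp y hy hyz
    refine argmax_eq_gradv hA hu hp (y := ⟨y, hy⟩) (le_antisymm ?_ (le_cj hA hu p ⟨y, hy⟩))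
    refine cj_le hne fun z => ?_
    have := hyz z z.2
    rw [inner_sub_right] at this
    simp only [u]
    linarith
  set T := gradv (cj A u) with hT
  have hTm : Measurable T := measurable_gradv _
  -- one-sided inequality
  have key : ∀ h : BoundedContinuousFunction E ℝ,
      ν.real Set.univ * ∫ p, h (T p) ∂μ ≤ μ.real Set.univ * ∫ y : A, h y ∂ν := by
    intro h
    let hA' : A → ℝ := fun y => h y
    have hhc : Continuous hA' := h.continuous.comp continuous_subtype_val
    let t : ℕ → ℝ := fun n => 1 / ((n : ℝ) + 1)
    have ht : ∀ n, 0 < t n := fun n => by positivity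
    have htl : Tendsto t atTop (𝓝 0) := tendsto_one_div_add_atTop_nhds_zero_nat
    let d : ℕ → E → ℝ := fun n p => (cj A (fun z => u z + t n * hA' z) p - cj A u p) / t n
    have hvc : ∀ n, Continuous (fun z => u z + t n * hA' z) := fun n => by fun_prop
    have hb : ∀ y, |hA' y| ≤ ‖h‖ := fun y => h.norm_coe_le_norm y
    have hdc : ∀ n, Continuous (d n) := fun n =>
      (((cj_lip hA hne (hvc n) hR).continuous).sub hlip.continuous).div_const _
    have hlim : Tendsto (fun n => ∫ p, d n p ∂μ) atTop (𝓝 (∫ p, - h (T p) ∂μ)) := by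
      refine tendsto_integral_of_dominated_convergence (fun _ => ‖h‖)
        (fun n => (hdc n).aestronglyMeasurable) (integrable_const _) (fun n => ?_) ?_
      · refine Eventually.of_forall fun p => ?_
        have hbn : ∀ y, |t n * hA' y| ≤ t n * ‖h‖ := fun y => by
          rw [abs_mul, abs_of_pos (ht n)]; exact mul_le_mul_of_nonneg_left (hb y) (ht n).le
        have e1 := cj_sub_le hA hne hu (f := fun z => u z + t n * hA' z) (c := t n * ‖h‖)
          (fun z => by have := (abs_le.1 (hbn z)).1; linarith) p
        have e2 := cj_sub_le hA hne (hvc n) (f := u) (c := t n * ‖h‖)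
          (fun z => by have := (abs_le.1 (hbn z)).2; linarith) p
        simp only [d]
        rw [norm_div, Real.norm_of_nonneg (ht n).le, div_le_iff₀ (ht n), Real.norm_eq_abs, abs_le]
        constructor <;> linarith
      · filter_upwards [hdiff] with p hp
        obtain ⟨y, hy⟩ := cj_attained hA hne hu p
        have hyT := argmax_eq_gradv hA hu hp hy
        have := quot_tendsto hA hne hu hhc hb hy (fun z hz =>
          Subtype.ext ((argmax_eq_gradv hA hu hp hz).trans hyT.symm)) t ht htl
        simp only [hA'] at this
        rw [hyT] at this
        exact this
    have hge : ∀ n, 0 ≤ ν.real Set.univ * (∫ p, d n p ∂μ) + μ.real Set.univ * ∫ y, hA' y ∂ν := by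
      intro n
      have h1 := hmin _ (hvc n)
      unfold dualJ at h1
      have i1 := cont_integrable hK μ hμK hlip.continuous
      have i2 := cont_integrable hK μ hμK (cj_lip hA hne (hvc n) hR).continuous
      rw [integral_add (cont_integrable' hA ν hu) ((cont_integrable' hA ν hhc).const_mul _),
        integral_const_mul] at h1
      have h2 : ∫ p, d n p ∂μ = (∫ p, cj A (fun z => u z + t n * hA' z) p ∂μ - ∫ p, cj A u p ∂μ) / t n := by
        simp only [d]
        rw [integral_div, integral_sub i2 i1]
      have h3 : t n * (∫ p, d n p ∂μ) = (∫ p, cj A (fun z => u z + t n * hA' z) p ∂μ - ∫ p, cj A u p ∂μ) := by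
        rw [h2]; field_simp [(ht n).ne']
      have h4 : 0 ≤ t n * (ν.real Set.univ * (∫ p, d n p ∂μ) + μ.real Set.univ * ∫ y, hA' y ∂ν) := by
        have : t n * (ν.real Set.univ * (∫ p, d n p ∂μ)) =
          ν.real Set.univ * (t n * (∫ p, d n p ∂μ)) := by ring
        rw [mul_add, this, h3]
        simp only [u] at *
        linarith
      exact (mul_nonneg_iff_of_pos_left (ht n)).1 h4
    have hfin := ge_of_tendsto' ((hlim.const_mul (ν.real Set.univ)).add_const
      (μ.real Set.univ * ∫ y, hA' y ∂ν)) hge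
    rw [integral_neg] at hfin
    simp only [hA'] at hfin
    linarith
  have key2 : ∀ h : BoundedContinuousFunction E ℝ,
      ν.real Set.univ * ∫ p, h (T p) ∂μ = μ.real Set.univ * ∫ y : A, h y ∂ν := by
    intro h
    refine le_antisymm (key h) ?_
    have := key (-h)
    simp only [BoundedContinuousFunction.coe_neg, Pi.neg_apply, integral_neg] at this
    linarith
  have : IsFiniteMeasure (μ.map T) := Measure.isFiniteMeasure_map μ T
  have : IsFiniteMeasure (vol.restrict A) := ⟨by simpa using hAfin⟩
  have : IsFiniteMeasure ((vol A) • μ.map T) := Measure.smul_finite _ hAfin.ne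
  have : IsFiniteMeasure ((μ Set.univ) • vol.restrict A) := Measure.smul_finite _ (measure_ne_top μ _)
  refine ext_of_forall_integral_eq_of_IsFiniteMeasure fun h => ?_
  rw [integral_smul_measure, integral_smul_measure,
    integral_map hTm.aemeasurable h.continuous.aestronglyMeasurable]
  have h1 := key2 h
  rw [integral_subtype_comap hAm (fun y => h y)] at h1
  simp only [Measure.real, hνu] at h1
  simpa using h1

end Brenier2

section Proj
variable {E : Type*} [NormedAddCommGroup E] [InnerProductSpace ℝ E]
variable [FiniteDimensional ℝ E]

lemma sum_prox_onto {m : ℕ} {B : Fin m → Set E} (hK : ∀ k, IsCompact (B k))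
    {P : Fin m → E → E} (hP : ∀ k, IsProx (B k) (fun _ => 0) (P k)) {s : E}
    (hs : s ∈ interior (∑ k, B k)) : ∃ p, ∑ k, P k p = s := by
  choose R hR using fun k => exists_bound (hK k)
  obtain ⟨ε, hε, hball⟩ := Metric.isOpen_iff.1 isOpen_interior s hs
  set C : ℝ := ∑ k, (R k : ℝ) ^ 2 / 2 with hC
  let Γ : E → ℝ := fun p => ∑ k, proxPot (fun _ => 0) (P k) p - inner ℝ s p
  have hlow : ∀ p : E, (ε / 2) * ‖p‖ - C ≤ Γ p := by
    intro p
    have hmem : s + (ε / 2 / ‖p‖) • p ∈ ∑ k, B k := by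
      apply interior_subset
      apply hball
      rw [mem_ball_iff_norm, add_sub_cancel_left, norm_smul, norm_div, norm_norm, Real.norm_of_nonneg (by positivity)]
      rcases eq_or_ne ‖p‖ 0 with h | h
      · rw [h]; simpa using hε
      · rw [div_mul_cancel₀ _ h]; linarith
    rw [Set.mem_fintype_sum] at hmem
    obtain ⟨x, hx, hsum⟩ := hmem
    have h1 : ∀ k, inner ℝ p (x k) - (R k : ℝ) ^ 2 / 2 ≤ proxPot (fun _ => 0) (P k) p := by
      intro k
      have h2 := (hP k).pot_ge p (x k) (hx k)
      have h3 := hR k (x k) (hx k)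
      have h4 : ‖x k‖ ^ 2 ≤ (R k : ℝ) ^ 2 := by gcongr
      linarith
    have h5 := Finset.sum_le_sum (fun k (_ : k ∈ Finset.univ) => h1 k)
    rw [Finset.sum_sub_distrib, ← inner_sum, hsum, inner_add_right, inner_smul_right,
      real_inner_self_eq_norm_sq] at h5
    have h6 : ε / 2 / ‖p‖ * ‖p‖ ^ 2 = ε / 2 * ‖p‖ := by
      rcases eq_or_ne ‖p‖ 0 with h | h
      · rw [h]; simp
      · field_simp
    rw [h6, real_inner_comm] at h5
    simp only [Γ]
    linarith
  have hder : ∀ p, HasFDerivAt Γ (innerSL ℝ (∑ k, P k p) - innerSL ℝ s) p := by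
    intro p
    have h1 : HasFDerivAt (fun p => ∑ k, proxPot (fun _ => 0) (P k) p) (∑ k, innerSL ℝ (P k p)) p :=
      HasFDerivAt.fun_sum fun k _ => (hP k).hasFDerivAt p
    rw [map_sum]
    exact h1.sub (innerSL ℝ s).hasFDerivAt
  have hcont : Continuous Γ := continuous_iff_continuousAt.2 fun p => (hder p).continuousAt
  have hlim : Filter.Tendsto Γ (Filter.cocompact E) Filter.atTop := by
    refine Filter.tendsto_atTop_mono hlow ?_
    exact Filter.tendsto_atTop_add_const_right _ _
      ((tendsto_norm_cocompact_atTop).const_mul_atTop (by positivity))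
  obtain ⟨p, hp⟩ := hcont.exists_forall_le hlim
  refine ⟨p, ?_⟩
  have h0 := IsLocalMin.hasFDerivAt_eq_zero (Filter.Eventually.of_forall hp) (hder p)
  have := congrArg (fun L : E →L[ℝ] ℝ => L (∑ k, P k p - s)) h0
  simp only [sub_apply, innerSL_apply_apply, zero_apply,
    ← inner_sub_left] at this
  exact sub_eq_zero.1 (inner_self_eq_zero.1 this)

variable [MeasurableSpace E] [BorelSpace E]

lemma lip_null (vol : Measure E) [vol.IsAddHaarMeasure] {f : E → E} {C : NNReal}
    (hf : LipschitzWith C f) {N : Set E} (hN : vol N = 0) : vol (f '' N) = 0 := by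
  have ac1 : (Measure.hausdorffMeasure (Module.finrank ℝ E : ℝ) : Measure E) ≪ vol :=
    Measure.absolutelyContinuous_isAddHaarMeasure _ _
  have ac2 : vol ≪ (Measure.hausdorffMeasure (Module.finrank ℝ E : ℝ) : Measure E) :=
    Measure.absolutelyContinuous_isAddHaarMeasure _ _
  apply ac2
  have h := hf.hausdorffMeasure_image_le (d := (Module.finrank ℝ E : ℝ)) (by positivity) N
  rw [ac1 hN, mul_zero] at h
  exact le_antisymm h bot_le

lemma vol_sum_le (vol : Measure E) [vol.IsAddHaarMeasure] {m : ℕ} {B : Fin m → Set E}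
    (hK : ∀ k, IsCompact (B k)) (hc : ∀ k, Convex ℝ (B k))
    {P : Fin m → E → E} (hP : ∀ k, IsProx (B k) (fun _ => 0) (P k)) :
    vol (∑ k, B k) ≤ ∫⁻ p, ENNReal.ofReal |(∑ k, fderiv ℝ (P k) p).det| ∂vol := by
  set D : Set E := {p | ∀ k, DifferentiableAt ℝ (P k) p} with hD
  have hDm : MeasurableSet D := by
    have : D = ⋂ k, {p | DifferentiableAt ℝ (P k) p} := by ext; simp [hD]
    rw [this]
    exact MeasurableSet.iInter fun k => measurableSet_of_differentiableAt ℝ (P k)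
  have hDn : vol Dᶜ = 0 := by
    have : ∀ᵐ p ∂vol, ∀ k, DifferentiableAt ℝ (P k) p :=
      ae_all_iff.2 fun k => (hP k).fne.lip.ae_differentiableAt
    exact this
  set G : E → E := fun p => ∑ k, P k p with hG
  have hGl : ∃ C, LipschitzWith C G := by
    refine ⟨∑ _k : Fin m, 1, ?_⟩
    refine LipschitzWith.of_dist_le_mul fun x y => ?_
    rw [hG, dist_eq_norm, ← Finset.sum_sub_distrib]
    refine (norm_sum_le _ _).trans ?_
    push_cast
    rw [Finset.sum_mul]
    refine Finset.sum_le_sum fun k _ => ?_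
    have := (hP k).fne.lip.dist_le_mul x y
    rwa [dist_eq_norm] at this
  obtain ⟨C, hGl⟩ := hGl
  have hconv : Convex ℝ (∑ k, B k) := convex_sum _ fun k _ => hc k
  have h1 : vol (∑ k, B k) ≤ vol (interior (∑ k, B k)) := by
    have h2 := hconv.addHaar_frontier vol
    calc vol (∑ k, B k) ≤ vol (interior (∑ k, B k) ∪ frontier (∑ k, B k)) := by
          apply measure_mono
          intro x hx
          by_cases h : x ∈ interior (∑ k, B k)
          · exact Or.inl h
          · exact Or.inr ⟨subset_closure hx, h⟩
      _ ≤ _ := (measure_union_le _ _).trans (by rw [h2, add_zero])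
  have h3 : interior (∑ k, B k) ⊆ G '' D ∪ G '' Dᶜ := by
    intro s hs
    obtain ⟨p, hp⟩ := sum_prox_onto hK hP hs
    rw [← Set.image_union, Set.union_compl_self]
    exact ⟨p, trivial, hp⟩
  calc vol (∑ k, B k) ≤ vol (G '' D ∪ G '' Dᶜ) := h1.trans (measure_mono h3)
    _ ≤ vol (G '' D) + vol (G '' Dᶜ) := measure_union_le _ _
    _ = vol (G '' D) := by rw [lip_null vol hGl hDn, add_zero]
    _ ≤ ∫⁻ p in D, ENNReal.ofReal |(∑ k, fderiv ℝ (P k) p).det| ∂vol := by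
        refine addHaar_image_le_lintegral_abs_det_fderiv vol hDm ?_
        intro p hp
        exact (HasFDerivAt.fun_sum fun k _ => (hp k).hasFDerivAt).hasFDerivWithinAt
    _ ≤ _ := setLIntegral_le_lintegral _ _

end Proj

section Main
open scoped ENNReal

lemma holder_step {α : Type*} [MeasurableSpace α] (ν : Measure α) {m : ℕ} (hm : 1 ≤ m)
    (a M : ℝ≥0∞) (hM0 : M ≠ 0) (hM : M ≠ ∞) (w h : α → ℝ≥0∞) (hw : Measurable w)
    (f : Fin m → α → ℝ≥0∞)
    (hf : ∀ k, AEMeasurable (f k) ν) (h1 : ∀ᵐ x ∂ν, a * w x ≤ M * h x)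
    (h2 : ∀ᵐ x ∂ν, h x ^ (m - 1) * w x ≤ ∏ k, f k x) (h3 : M ≤ ∫⁻ x, w x ∂ν) :
    a ^ (m - 1) * M ≤ ∏ k, ∫⁻ x, f k x ∂ν := by
  have hm0 : (m : ℝ) ≠ 0 := by positivity
  have hpt : ∀ᵐ x ∂ν, (a ^ (m - 1)) ^ (1 / (m : ℝ)) * w x ≤
      (M ^ (m - 1)) ^ (1 / (m : ℝ)) * ∏ k, f k x ^ (1 / (m : ℝ)) := by
    filter_upwards [h1, h2] with x hx1 hx2
    have e1 : a ^ (m - 1) * w x ^ m ≤ M ^ (m - 1) * ∏ k, f k x := by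
      calc a ^ (m - 1) * w x ^ m = (a * w x) ^ (m - 1) * w x := by
            rw [mul_pow, mul_assoc, ← pow_succ, Nat.sub_add_cancel hm]
        _ ≤ (M * h x) ^ (m - 1) * w x := by gcongr
        _ = M ^ (m - 1) * (h x ^ (m - 1) * w x) := by rw [mul_pow, mul_assoc]
        _ ≤ _ := by gcongr
    have e2 := ENNReal.rpow_le_rpow e1 (z := 1 / (m : ℝ)) (by positivity)
    rw [ENNReal.mul_rpow_of_nonneg _ _ (by positivity),
      ENNReal.mul_rpow_of_nonneg _ _ (by positivity), ← ENNReal.rpow_natCast (w x) m,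
      ← ENNReal.rpow_mul, mul_one_div_cancel hm0, ENNReal.rpow_one,
      ← ENNReal.prod_rpow_of_nonneg (by positivity)] at e2
    exact e2
  have hIntg : (a ^ (m - 1)) ^ (1 / (m : ℝ)) * M ≤
      (M ^ (m - 1)) ^ (1 / (m : ℝ)) * ∏ k, (∫⁻ x, f k x ∂ν) ^ (1 / (m : ℝ)) := by
    calc (a ^ (m - 1)) ^ (1 / (m : ℝ)) * M
        ≤ (a ^ (m - 1)) ^ (1 / (m : ℝ)) * ∫⁻ x, w x ∂ν := by gcongr
      _ = ∫⁻ x, (a ^ (m - 1)) ^ (1 / (m : ℝ)) * w x ∂ν := (lintegral_const_mul _ hw).symm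
      _ ≤ ∫⁻ x, (M ^ (m - 1)) ^ (1 / (m : ℝ)) * ∏ k, f k x ^ (1 / (m : ℝ)) ∂ν :=
          lintegral_mono_ae hpt
      _ = (M ^ (m - 1)) ^ (1 / (m : ℝ)) * ∫⁻ x, ∏ k, f k x ^ (1 / (m : ℝ)) ∂ν := by
          rw [lintegral_const_mul']
          exact ENNReal.rpow_ne_top_of_nonneg (by positivity) (ENNReal.pow_ne_top hM)
      _ ≤ _ := by
          gcongr
          refine ENNReal.lintegral_prod_norm_pow_le Finset.univ (fun k _ => hf k) ?_ ?_
          · simp [hm0]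
          · intro k _; positivity
  have hpow := ENNReal.rpow_le_rpow hIntg (z := (m : ℝ)) (by positivity)
  rw [ENNReal.mul_rpow_of_nonneg _ _ (by positivity),
      ENNReal.mul_rpow_of_nonneg _ _ (by positivity), ← ENNReal.rpow_mul, ← ENNReal.rpow_mul,
      one_div_mul_cancel hm0, ENNReal.rpow_one, ENNReal.rpow_one,
      ENNReal.prod_rpow_of_nonneg (by positivity), ← ENNReal.rpow_mul,
      one_div_mul_cancel hm0, ENNReal.rpow_one, ENNReal.rpow_natCast] at hpow
  have e3 : a ^ (m - 1) * M ^ m = M ^ (m - 1) * (a ^ (m - 1) * M) := by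
    conv_lhs => rw [← Nat.sub_add_cancel hm, pow_succ]
    rw [Nat.add_sub_cancel]; ring
  rw [e3] at hpow
  exact (ENNReal.mul_le_mul_iff_right (pow_ne_zero _ hM0) (ENNReal.pow_ne_top hM)).1 hpow

variable {E : Type*} [NormedAddCommGroup E] [InnerProductSpace ℝ E]

lemma prox_compl_onto {A : Set E} (hA : IsCompact A) (hne : A.Nonempty) {u : E → ℝ}
    (hu : Continuous u) {Y : E → E} (hY : IsProx A u Y) (p : E) : ∃ r, r - Y r = p := by
  obtain ⟨y, hy, hmin⟩ := hA.exists_isMinOn hne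
    (f := fun z => u z - inner ℝ p z) (by fun_prop)
  refine ⟨p + y, ?_⟩
  set z := Y (p + y) with hz
  have h1 := hY.vi (p + y) y hy
  have h2 := hmin (hY.mem (p + y))
  simp only [Set.mem_ofPred_eq] at h2
  rw [← hz] at h1 h2
  have h3 : p + y - z = p + (y - z) := by abel
  rw [h3, inner_add_left, inner_sub_right, real_inner_self_eq_norm_sq] at h1
  have h4 : ‖y - z‖ ^ 2 ≤ 0 := by linarith
  have h5 : ‖y - z‖ = 0 := by nlinarith [norm_nonneg (y - z)]
  rw [h3, norm_eq_zero.1 h5, add_zero]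

lemma clm_inj_of_det [FiniteDimensional ℝ E] {D : E →L[ℝ] E} (hD : D.det ≠ 0) {v : E}
    (hv : D v = 0) : v = 0 := by
  by_contra hne
  apply hD
  change LinearMap.det (D : E →ₗ[ℝ] E) = 0
  by_contra hdet
  have hk : LinearMap.ker (D : E →ₗ[ℝ] E) = ⊥ := by
    exact LinearMap.ker_eq_bot.2 (LinearEquiv.ofIsUnitDet (f := (D : E →ₗ[ℝ] E)) (v := Module.finBasis ℝ E) (v' := Module.finBasis ℝ E) (by simpa using hdet)).injective
  exact hne (LinearMap.ker_eq_bot'.1 hk v hv)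

lemma comb_inj [FiniteDimensional ℝ E] {Y P : E → E} (hY : FNE Y) (hP : FNE P) {r r' : E}
    {D : E →L[ℝ] E} (hD : HasFDerivAt Y D r) (hdet : D.det ≠ 0)
    (he : Y r + P (r - Y r) = Y r' + P (r' - Y r')) : r = r' := by
  have h1 := hY r r'
  have h2 := hP (r - Y r) (r' - Y r')
  have h3 : P (r - Y r) - P (r' - Y r') = - (Y r - Y r') := by
    have := sub_eq_zero.2 he
    rw [← sub_eq_zero]
    rw [← this]; abel
  rw [h3, norm_neg, inner_neg_left] at h2
  have h4 : r - Y r - (r' - Y r') = (r - r') - (Y r - Y r') := by abel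
  rw [h4, inner_sub_right, real_inner_self_eq_norm_sq] at h2
  have h5 : ‖Y r - Y r'‖ ^ 2 ≤ 0 := by nlinarith
  have h6 : Y r = Y r' := by
    rw [← sub_eq_zero, ← norm_eq_zero]; nlinarith [norm_nonneg (Y r - Y r')]
  have := clm_inj_of_det hdet (hY.deriv_ker h6 hD)
  exact (sub_eq_zero.1 this).symm

variable [FiniteDimensional ℝ E] [MeasurableSpace E] [BorelSpace E]

lemma transport_le {A : Set E} (vol : Measure E) (μ : Measure E) {u : E → ℝ} {Y T : E → E}
    (hY : IsProx A u Y) (hTm : Measurable T) {M : ℝ≥0∞}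
    (hT : (vol A) • μ.map T = M • vol.restrict A)
    (hae : ∀ᵐ p ∂μ, ∀ y ∈ A, (∀ z ∈ A, u y + inner ℝ p (z - y) ≤ u z) → y = T p)
    (S : Set E) : vol A * μ ((fun r => r - Y r) '' S) ≤ M * vol (Y '' S) := by
  set Z := toMeasurable vol (Y '' S) with hZ
  have hZm : MeasurableSet Z := measurableSet_toMeasurable _ _
  have h1 : μ ((fun r => r - Y r) '' S) ≤ μ (T ⁻¹' Z) := by
    apply measure_mono_ae
    filter_upwards [hae] with p hp hpS
    obtain ⟨r, hr, rfl⟩ := hpS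
    have := hp (Y r) (hY.mem r) (hY.vi r)
    change T _ ∈ Z
    rw [← this]
    exact subset_toMeasurable _ _ ⟨r, hr, rfl⟩
  rw [← Measure.map_apply hTm hZm] at h1
  have h2 := congrArg (fun ν : Measure E => ν Z) hT
  simp only [Measure.smul_apply, smul_eq_mul] at h2
  calc _ ≤ vol A * μ.map T Z := by gcongr
    _ = M * vol.restrict A Z := h2
    _ ≤ M * vol Z := by gcongr; exact Measure.restrict_le_self
    _ = _ := by rw [hZ, measure_toMeasurable]

end Main

section MainIneq
open scoped ENNReal
variable {E : Type*} [NormedAddCommGroup E] [InnerProductSpace ℝ E]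
variable [FiniteDimensional ℝ E] [MeasurableSpace E] [BorelSpace E]

lemma meas_b {m : ℕ} (P : Fin m → E → E) :
    Measurable (fun p => ENNReal.ofReal |(∑ k, fderiv ℝ (P k) p).det|) := by
  have h1 : Measurable (fun p => ∑ k, fderiv ℝ (P k) p) :=
    Finset.measurable_sum _ fun k _ => measurable_fderiv ℝ (P k)
  have h2 : Measurable (fun D : E →L[ℝ] E => ENNReal.ofReal |D.det|) :=
    (ENNReal.continuous_ofReal.comp ContinuousLinearMap.continuous_det.abs).measurable
  exact h2.comp h1

lemma bdd_b {m : ℕ} {P : Fin m → E → E} (hP : ∀ k, LipschitzWith 1 (P k)) :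
    ∃ c : NNReal, ∀ p, ENNReal.ofReal |(∑ k, fderiv ℝ (P k) p).det| ≤ c := by
  have hc : IsCompact (Metric.closedBall (0 : E →L[ℝ] E) m) := isCompact_closedBall _ _
  obtain ⟨c, hcb⟩ := (hc.image (f := fun D : E →L[ℝ] E => |D.det|)
    ContinuousLinearMap.continuous_det.abs).bddAbove
  refine ⟨Real.toNNReal c, fun p => ?_⟩
  apply ENNReal.ofReal_le_ofReal
  apply hcb
  refine ⟨_, ?_, rfl⟩
  rw [mem_closedBall_zero_iff]
  refine (norm_sum_le _ _).trans ?_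
  calc ∑ k, ‖fderiv ℝ (P k) p‖ ≤ ∑ _k : Fin m, (1 : ℝ) :=
        Finset.sum_le_sum fun k _ => by simpa using norm_fderiv_le_of_lipschitz ℝ (hP k)
    _ = m := by simp

lemma main_R (vol : Measure E) [vol.IsAddHaarMeasure] {m : ℕ} (hm : 1 ≤ m) {A : Set E}
    (hA : IsCompact A) (hAc : Convex ℝ A) (hne : A.Nonempty) (hA0 : vol A ≠ 0) {B : Fin m → Set E}
    {P : Fin m → E → E} (hP : ∀ k, IsProx (B k) (fun _ => 0) (P k)) (R : ℝ) (hR : 0 ≤ R) :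
    vol A ^ (m - 1) * ∫⁻ p in Metric.closedBall 0 R,
      ENNReal.ofReal |(∑ k, fderiv ℝ (P k) p).det| ∂vol ≤ ∏ k, vol (A + B k) := by
  set K : Set E := Metric.closedBall 0 R with hK
  have hKm : MeasurableSet K := measurableSet_closedBall
  have hKc : IsCompact K := isCompact_closedBall _ _
  set b : E → ℝ≥0∞ := fun p => ENNReal.ofReal |(∑ k, fderiv ℝ (P k) p).det| with hb
  have hbm : Measurable b := meas_b P
  set M := ∫⁻ p in K, b p ∂vol with hMdef
  have hMtop : M ≠ ∞ := by
    obtain ⟨c, hc⟩ := bdd_b (fun k => (hP k).fne.lip)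
    refine ne_top_of_le_ne_top ?_ (setLIntegral_mono (g := fun _ => (c : ℝ≥0∞)) measurable_const
      fun p _ => hc p)
    rw [setLIntegral_const]
    exact ENNReal.mul_ne_top ENNReal.coe_ne_top hKc.measure_lt_top.ne
  rcases eq_or_ne M 0 with hM0 | hM0
  · rw [hM0, mul_zero]; exact bot_le
  set μ : Measure E := (vol.withDensity b).restrict K with hμ
  have hμu : μ Set.univ = M := by
    rw [hμ, Measure.restrict_apply_univ, withDensity_apply _ hKm]
  have : IsFiniteMeasure μ := ⟨by rw [hμu]; exact hMtop.lt_top⟩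
  have hμK : μ Kᶜ = 0 := by rw [hμ, Measure.restrict_apply hKm.compl]; simp
  have hac : μ ≪ vol :=
    Measure.absolutelyContinuous_restrict.trans (withDensity_absolutelyContinuous _ _)
  obtain ⟨u, huc, hucv, T, hTm, hT, hae⟩ :=
    brenier hA hne hKc (Metric.nonempty_closedBall.2 hR) vol μ hμK hac
  rw [hμu] at hT
  obtain ⟨Y, hY⟩ := exists_isProx hAc hA hne (hucv.subset (Set.subset_univ _) hAc)
    huc.continuousOn
  have htr := transport_le vol μ hY hTm hT hae
  set q : E → E := fun r => r - Y r with hq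
  have hqf : FNE q := hY.fne.compl
  have hqc : Continuous q := hqf.lip.continuous
  set Q : E → E →L[ℝ] E := fun r => ContinuousLinearMap.id ℝ E - fderiv ℝ Y r with hQ
  have hqd : ∀ r, DifferentiableAt ℝ Y r → HasFDerivAt q (Q r) r := fun r hr =>
    (hasFDerivAt_id r).sub hr.hasFDerivAt
  have hHm : Measurable (fun r => fderiv ℝ Y r) := measurable_fderiv ℝ Y
  have hQm : Measurable Q := hHm.const_sub _
  have hdetm : Measurable (fun D : E →L[ℝ] E => D.det) :=
    ContinuousLinearMap.continuous_det.measurable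
  have habsm : Measurable (fun D : E →L[ℝ] E => ENNReal.ofReal |D.det|) :=
    (ENNReal.continuous_ofReal.comp ContinuousLinearMap.continuous_det.abs).measurable
  set DP : Set E := {p | ∀ k, DifferentiableAt ℝ (P k) p} with hDP
  have hDPm : MeasurableSet DP := by
    have : DP = ⋂ k, {p | DifferentiableAt ℝ (P k) p} := by ext; simp [hDP]
    rw [this]
    exact MeasurableSet.iInter fun k => measurableSet_of_differentiableAt ℝ (P k)
  have hDPn : vol DPᶜ = 0 := by
    have : ∀ᵐ p ∂vol, ∀ k, DifferentiableAt ℝ (P k) p :=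
      ae_all_iff.2 fun k => (hP k).fne.lip.ae_differentiableAt
    exact this
  set DY : Set E := {r | DifferentiableAt ℝ Y r} with hDY
  have hDYm : MeasurableSet DY := measurableSet_of_differentiableAt ℝ Y
  have hDYn : vol DYᶜ = 0 := hY.fne.lip.ae_differentiableAt
  set E1 : Set E := DY ∩ {r | (fderiv ℝ Y r).det ≠ 0} ∩ {r | (Q r).det ≠ 0} ∩ q ⁻¹' (K ∩ DP)
    with hE1
  have hE1m : MeasurableSet E1 := by
    refine ((hDYm.inter ?_).inter ?_).inter (hqc.measurable (hKm.inter hDPm))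
    · exact (hdetm.comp hHm) (measurableSet_singleton (0 : ℝ)).compl
    · exact (hdetm.comp hQm) (measurableSet_singleton (0 : ℝ)).compl
  -- the image of `E1` under `q` has full measure
  have hfull : M ≤ μ (q '' E1) := by
    have hcov : Set.univ ⊆ q '' E1 ∪ (Kᶜ ∪ (DPᶜ ∪ (q '' DYᶜ ∪
        (q '' (DY ∩ {r | (Q r).det = 0}) ∪ q '' (DY ∩ {r | (fderiv ℝ Y r).det = 0}))))) := by
      intro p _
      obtain ⟨r, hr⟩ := prox_compl_onto hA hne huc hY p
      change q r = p at hr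
      by_cases h1 : p ∈ K
      swap
      · exact Or.inr (Or.inl h1)
      by_cases h2 : p ∈ DP
      swap
      · exact Or.inr (Or.inr (Or.inl h2))
      by_cases h3 : r ∈ DY
      swap
      · exact Or.inr (Or.inr (Or.inr (Or.inl ⟨r, h3, hr⟩)))
      by_cases h4 : (Q r).det = 0
      · exact Or.inr (Or.inr (Or.inr (Or.inr (Or.inl ⟨r, ⟨h3, h4⟩, hr⟩))))
      by_cases h5 : (fderiv ℝ Y r).det = 0
      · exact Or.inr (Or.inr (Or.inr (Or.inr (Or.inr ⟨r, ⟨h3, h5⟩, hr⟩))))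
      refine Or.inl ⟨r, ⟨⟨⟨h3, h5⟩, h4⟩, ?_⟩, hr⟩
      change q r ∈ K ∩ DP
      rw [hr]; exact ⟨h1, h2⟩
    have z1 : μ DPᶜ = 0 := hac hDPn
    have z2 : μ (q '' DYᶜ) = 0 := hac (lip_null vol hqf.lip hDYn)
    have z3 : μ (q '' (DY ∩ {r | (Q r).det = 0})) = 0 := by
      apply hac
      exact addHaar_image_eq_zero_of_det_fderivWithin_eq_zero vol
        (fun r hr => (hqd r hr.1).hasFDerivWithinAt) (fun r hr => hr.2)
    have z4 : μ (q '' (DY ∩ {r | (fderiv ℝ Y r).det = 0})) = 0 := by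
      have h1 : vol (Y '' (DY ∩ {r | (fderiv ℝ Y r).det = 0})) = 0 :=
        addHaar_image_eq_zero_of_det_fderivWithin_eq_zero vol
          (fun r hr => (DifferentiableAt.hasFDerivAt hr.1).hasFDerivWithinAt) (fun r hr => hr.2)
      have h2 := htr (DY ∩ {r | (fderiv ℝ Y r).det = 0})
      rw [h1, mul_zero] at h2
      exact (mul_eq_zero.1 (le_antisymm h2 bot_le)).resolve_left hA0
    have z := measure_union_null hμK (measure_union_null z1
      (measure_union_null z2 (measure_union_null z3 z4)))
    calc M = μ Set.univ := hμu.symm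
      _ ≤ _ := measure_mono hcov
      _ ≤ _ := measure_union_le _ _
      _ = μ (q '' E1) := by rw [z, add_zero]
  have hqinj : Set.InjOn q E1 := by
    intro r hr r' _ he
    have := clm_inj_of_det hr.1.2 (hqf.deriv_ker he (hqd r hr.1.1.1))
    exact (sub_eq_zero.1 this).symm
  set w : E → ℝ≥0∞ := fun r => ENNReal.ofReal |(Q r).det| * b (q r) with hw
  have hwm : Measurable w := (habsm.comp hQm).mul (hbm.comp hqc.measurable)
  have hchange : ∀ S, MeasurableSet S → S ⊆ E1 → μ (q '' S) = ∫⁻ r in S, w r ∂vol := by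
    intro S hS hSE
    have hd : ∀ r ∈ S, HasFDerivWithinAt q (Q r) S r := fun r hr =>
      (hqd r (hSE hr).1.1.1).hasFDerivWithinAt
    have hinj : Set.InjOn q S := hqinj.mono hSE
    have hqSm : MeasurableSet (q '' S) := measurable_image_of_fderivWithin hS hd hinj
    have hsub : q '' S ∩ K = q '' S := by
      apply Set.inter_eq_left.2
      rintro _ ⟨r, hr, rfl⟩
      exact (hSE hr).2.1
    rw [hμ, Measure.restrict_apply hqSm, hsub, withDensity_apply _ hqSm,
      lintegral_image_eq_lintegral_abs_det_fderiv_mul vol hS hd hinj]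
  -- Monge-Ampere inequality
  have hMA : ∀ᵐ r ∂(vol.restrict E1),
      vol A * w r ≤ M * ENNReal.ofReal |(fderiv ℝ Y r).det| := by
    refine ae_le_of_forall_setLIntegral_le_of_sigmaFinite (hwm.const_mul _) ?_
    intro S hS _
    rw [Measure.restrict_restrict hS, lintegral_const_mul _ hwm,
      lintegral_const_mul' _ _ hMtop]
    have hSm : MeasurableSet (S ∩ E1) := hS.inter hE1m
    rw [← hchange _ hSm Set.inter_subset_right]
    refine (htr _).trans ?_
    gcongr
    exact addHaar_image_le_lintegral_abs_det_fderiv vol hSm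
      fun r hr => (DifferentiableAt.hasFDerivAt hr.2.1.1.1).hasFDerivWithinAt
  set f : Fin m → E → ℝ≥0∞ := fun k r =>
    ENNReal.ofReal |(fderiv ℝ Y r + (fderiv ℝ (P k) (q r)).comp (Q r)).det| with hf
  have hfm : ∀ k, Measurable (f k) := by
    intro k
    refine habsm.comp (hHm.add ?_)
    have h1 : Measurable (fun r => fderiv ℝ (P k) (q r)) :=
      (measurable_fderiv ℝ (P k)).comp hqc.measurable
    have h2 : Continuous (fun z : (E →L[ℝ] E) × (E →L[ℝ] E) => z.1.comp z.2) := by fun_prop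
    exact h2.measurable.comp (h1.prodMk hQm)
  have hfint : ∀ k, ∫⁻ r in E1, f k r ∂vol ≤ vol (A + B k) := by
    intro k
    have hd : ∀ r ∈ E1, HasFDerivWithinAt (fun r => Y r + P k (q r))
        (fderiv ℝ Y r + (fderiv ℝ (P k) (q r)).comp (Q r)) E1 r := by
      intro r hr
      refine HasFDerivAt.hasFDerivWithinAt ?_
      refine (DifferentiableAt.hasFDerivAt hr.1.1.1).add ?_
      exact (DifferentiableAt.hasFDerivAt (hr.2.2 k)).comp r (hqd r hr.1.1.1)
    have hinj : Set.InjOn (fun r => Y r + P k (q r)) E1 := by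
      intro r hr r' _ he
      exact comb_inj hY.fne (hP k).fne (DifferentiableAt.hasFDerivAt hr.1.1.1) hr.1.1.2 he
    rw [lintegral_abs_det_fderiv_eq_addHaar_image vol hE1m hd hinj]
    apply measure_mono
    rintro _ ⟨r, _, rfl⟩
    exact Set.add_mem_add (hY.mem r) ((hP k).mem _)
  have hkey : ∀ᵐ r ∂(vol.restrict E1),
      (ENNReal.ofReal |(fderiv ℝ Y r).det|) ^ (m - 1) * w r ≤ ∏ k, f k r := by
    filter_upwards [ae_restrict_mem hE1m] with r hr
    have hYd : HasFDerivAt Y (fderiv ℝ Y r) r := DifferentiableAt.hasFDerivAt hr.1.1.1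
    have h := clm_det_key hm (fderiv ℝ Y r) (Q r) (fun k => fderiv ℝ (P k) (q r))
      (by simp [hQ]) (hY.isPositive hYd) (hY.isPositive_compl hYd) hr.1.1.2 hr.1.2
      (fun k => (hP k).isPositive (DifferentiableAt.hasFDerivAt (hr.2.2 k)))
    have h' := ENNReal.ofReal_le_ofReal h
    rw [ENNReal.ofReal_mul (by positivity), ENNReal.ofReal_pow (by positivity),
      ENNReal.ofReal_mul (by positivity), ENNReal.ofReal_prod_of_nonneg (fun _ _ => abs_nonneg _)]
      at h'
    rw [mul_comm (ENNReal.ofReal |(∑ k, fderiv ℝ (P k) (q r)).det|)] at h'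
    exact h'
  have hfin := holder_step (vol.restrict E1) hm (vol A) M hM0 hMtop w _ hwm f
    (fun k => (hfm k).aemeasurable) hMA hkey
    (by rw [← hchange E1 hE1m le_rfl]; exact hfull)
  exact hfin.trans (Finset.prod_le_prod' fun k _ => hfint k)

theorem main_ineq (vol : Measure E) [vol.IsAddHaarMeasure] {m : ℕ} (hm : 1 ≤ m) {A : Set E}
    (hA : IsCompact A) (hAc : Convex ℝ A) (hne : A.Nonempty) (hA0 : vol A ≠ 0) {B : Fin m → Set E}
    (hB : ∀ k, IsCompact (B k)) (hBc : ∀ k, Convex ℝ (B k)) (hBne : ∀ k, (B k).Nonempty) :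
    vol A ^ (m - 1) * vol (∑ k, B k) ≤ ∏ k, vol (A + B k) := by
  have hP : ∀ k, ∃ P, IsProx (B k) (fun _ => 0) P := fun k =>
    exists_isProx (hBc k) (hB k) (hBne k) (convexOn_const 0 (hBc k)) continuousOn_const
  choose P hP using hP
  have h1 := vol_sum_le vol hB hBc hP
  set b : E → ℝ≥0∞ := fun p => ENNReal.ofReal |(∑ k, fderiv ℝ (P k) p).det| with hb
  have h2 : ∫⁻ p, b p ∂vol = ⨆ N : ℕ, ∫⁻ p in Metric.closedBall 0 (N : ℝ), b p ∂vol := by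
    rw [← setLIntegral_iUnion_of_directed, Metric.iUnion_closedBall_nat, setLIntegral_univ]
    exact directed_of_isDirected_le fun i j hij =>
      Metric.closedBall_subset_closedBall (by exact_mod_cast hij)
  rw [h2] at h1
  refine (mul_le_mul_right h1 _).trans ?_
  rw [ENNReal.mul_iSup]
  exact iSup_le fun N => main_R vol hm hA hAc hne hA0 hP N (by positivity)

end MainIneq

section Final
lemma sum_smul_convex {E ι : Type*} [AddCommGroup E] [Module ℝ E] {A : Set E} (hA : Convex ℝ A)
    (hne : A.Nonempty) (t : ℝ) (ht : 0 ≤ t) (s : Finset ι) :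
    ∑ _k ∈ s, t • A = ((s.card : ℝ) * t) • A := by
  classical
  induction s using Finset.induction with
  | empty => simp [Set.zero_smul_set hne]
  | insert a s ha ih =>
    rw [Finset.sum_insert ha, ih, ← hA.add_smul ht (by positivity), Finset.card_insert_of_notMem ha]
    push_cast
    congr 1
    ring

lemma compact_sum {E ι : Type*} [NormedAddCommGroup E] (s : Finset ι) (B : ι → Set E)
    (hB : ∀ k, IsCompact (B k)) : IsCompact (∑ k ∈ s, B k) := by
  classical
  induction s using Finset.induction with
  | empty => simp
  | insert a s ha ih =>
    rw [Finset.sum_insert ha]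
    exact (hB a).add ih
end Final

theorem minkowski_bezout_exponential_bound (n m : ℕ) (hm : 2 ≤ m)
    (A : Set (EuclideanSpace ℝ (Fin n))) (B : Fin m → Set (EuclideanSpace ℝ (Fin n)))
    (hA : IsConvexBody A) (hB : ∀ k, IsConvexBody (B k)) :
    (volume A).toReal ^ (m - 1) * (volume (A + ∑ k, B k)).toReal ≤
        (1 + 1 / ((m : ℝ) - 1)) ^ ((m - 1) * n) * ∏ k, (volume (A + B k)).toReal ∧
      (1 + 1 / ((m : ℝ) - 1)) ^ ((m - 1) * n) * ∏ k, (volume (A + B k)).toReal ≤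
        Real.exp 1 ^ n * ∏ k, (volume (A + B k)).toReal := by
  have hm0 : (0 : ℝ) < m := by positivity
  have hm2 : (2 : ℝ) ≤ m := by exact_mod_cast hm
  have hm1 : (0 : ℝ) < (m : ℝ) - 1 := by linarith
  have hcast : ((m - 1 : ℕ) : ℝ) = (m : ℝ) - 1 := by
    rw [Nat.cast_sub (by omega)]; simp
  have hprod : 0 ≤ ∏ k, (volume (A + B k)).toReal :=
    Finset.prod_nonneg fun k _ => ENNReal.toReal_nonneg
  obtain ⟨hAc, hAk, hAi⟩ := hA
  have hAne : A.Nonempty := hAi.mono interior_subset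
  constructor
  · set c : ℝ := 1 - 1 / (m : ℝ) with hc
    have hinv : (1 : ℝ) / m ≤ 1 / 2 := one_div_le_one_div_of_le (by norm_num) hm2
    have hc0 : 0 < c := by rw [hc]; linarith
    have ht : (0 : ℝ) ≤ 1 / (m : ℝ) := by positivity
    have hvA : volume (c • A) = ENNReal.ofReal (c ^ n) * volume A := by
      rw [Measure.addHaar_smul, finrank_euclideanSpace_fin, abs_of_pos (by positivity)]
    have hA0 : volume (c • A) ≠ 0 := by
      rw [hvA]
      refine mul_ne_zero ?_ (Measure.measure_pos_of_nonempty_interior _ hAi).ne'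
      rw [Ne, ENNReal.ofReal_eq_zero, not_le]
      positivity
    have key := main_ineq (volume : Measure (EuclideanSpace ℝ (Fin n))) (m := m) (by omega)
      (A := c • A) (hAk.smul c) (hAc.smul c) hAne.smul_set hA0
      (B := fun k => (1 / (m : ℝ)) • A + B k)
      (fun k => (hAk.smul _).add (hB k).2.1) (fun k => (hAc.smul _).add (hB k).1)
      (fun k => (hAne.smul_set).add ((hB k).2.2.mono interior_subset))
    have e1 : ∑ k, ((1 / (m : ℝ)) • A + B k) = A + ∑ k, B k := by
      rw [Finset.sum_add_distrib, sum_smul_convex hAc hAne _ ht]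
      simp [hm0.ne']
    have e2 : ∀ k, c • A + ((1 / (m : ℝ)) • A + B k) = A + B k := by
      intro k
      rw [← add_assoc, ← hAc.add_smul hc0.le ht, hc, sub_add_cancel, one_smul]
    simp only [e1, e2, hvA] at key
    have hfin : ∏ k, volume (A + B k) ≠ ⊤ :=
      ENNReal.prod_ne_top fun k _ => (hAk.add (hB k).2.1).measure_lt_top.ne
    have key2 := ENNReal.toReal_mono hfin key
    rw [ENNReal.toReal_mul, ENNReal.toReal_pow, ENNReal.toReal_mul, ENNReal.toReal_prod,
      ENNReal.toReal_ofReal (by positivity), mul_pow, ← pow_mul] at key2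
    have e3 : (1 + 1 / ((m : ℝ) - 1)) * c = 1 := by
      rw [hc]; field_simp; ring
    calc (volume A).toReal ^ (m - 1) * (volume (A + ∑ k, B k)).toReal
        = (1 + 1 / ((m : ℝ) - 1)) ^ ((m - 1) * n) * (c ^ (n * (m - 1)) *
          (volume A).toReal ^ (m - 1) * (volume (A + ∑ k, B k)).toReal) := by
          rw [mul_comm n, ← mul_assoc, ← mul_assoc, ← mul_pow, e3, one_pow, one_mul]
      _ ≤ _ := by gcongr
  · refine mul_le_mul_of_nonneg_right ?_ hprod
    rw [pow_mul]
    gcongr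
    have h1 : 1 + 1 / ((m : ℝ) - 1) ≤ Real.exp (1 / ((m : ℝ) - 1)) := by
      have := Real.add_one_le_exp (1 / ((m : ℝ) - 1)); linarith
    calc (1 + 1 / ((m : ℝ) - 1)) ^ (m - 1) ≤ Real.exp (1 / ((m : ℝ) - 1)) ^ (m - 1) := by gcongr
      _ = Real.exp 1 := by
        rw [← Real.exp_nat_mul, hcast, mul_one_div_cancel hm1.ne']
end

section
/- Let $m, n \geq 1$ and let $\alpha_1,\dots,\alpha_m \in \{1,\dots,n\}$ be integers with $d := \alpha_1+\cdots+\alpha_m - (m-1)n > 0$. If $c_{n,m}$ is the smallest constant such that $|A|^{m-1}|A+B_1+\cdots+B_m| \leq c_{n,m}\prod_{k=1}^m |A+B_k|$ for all convex bodies $A,B_1,\dots,B_m$ in $\mathbb{R}^n$, then $c_{n,m} \geq \frac{\prod_{i=1}^m \binom{\alpha_i}{d}}{\binom{n}{d}^{m-1}}$. -/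
open scoped Pointwise
open MeasureTheory

/-- `c` is an admissible constant for the Bézout type inequality for
Minkowski sums of `m` bodies with a body `A` in `ℝⁿ`. -/
def BezoutConst (n m : ℕ) (c : ℝ) : Prop :=
  ∀ (A : Set (EuclideanSpace ℝ (Fin n))) (B : Fin m → Set (EuclideanSpace ℝ (Fin n))),
    IsConvexBody A → (∀ k, IsConvexBody (B k)) →
    (volume A).toReal ^ (m - 1) * (volume (A + ∑ k, B k)).toReal ≤
      c * ∏ k, (volume (A + B k)).toReal

/-- sum of the two sup norms -/
noncomputable def gN {ι : Type*} [Fintype ι] (p : ι → Prop) [DecidablePred p] (x : ι → ℝ) : ℝ :=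
  ‖fun i : {i // p i} => x i‖ + ‖fun i : {i // ¬ p i} => x i‖

lemma gN_zero {ι : Type*} [Fintype ι] (p : ι → Prop) [DecidablePred p] : gN p 0 = 0 := by
  have h1 : (fun i : {i // p i} => (0 : ι → ℝ) i) = 0 := rfl
  have h2 : (fun i : {i // ¬ p i} => (0 : ι → ℝ) i) = 0 := rfl
  simp only [gN, h1, h2, norm_zero, add_zero]

lemma gN_smul {ι : Type*} [Fintype ι] (p : ι → Prop) [DecidablePred p] (r : ℝ) (x : ι → ℝ) :
    gN p (r • x) = |r| * gN p x := by
  have h1 : (fun i : {i // p i} => (r • x) i) = r • (fun i : {i // p i} => x i) := rfl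
  have h2 : (fun i : {i // ¬ p i} => (r • x) i) = r • (fun i : {i // ¬ p i} => x i) := rfl
  simp only [gN, h1, h2, norm_smul, Real.norm_eq_abs]; ring

lemma gN_neg {ι : Type*} [Fintype ι] (p : ι → Prop) [DecidablePred p] (x : ι → ℝ) :
    gN p (-x) = gN p x := by
  have := gN_smul p (-1) x
  simpa using this

lemma gN_add {ι : Type*} [Fintype ι] (p : ι → Prop) [DecidablePred p] (x y : ι → ℝ) :
    gN p (x + y) ≤ gN p x + gN p y := by
  have h1 := norm_add_le (fun i : {i // p i} => x i) (fun i : {i // p i} => y i)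
  have h2 := norm_add_le (fun i : {i // ¬ p i} => x i) (fun i : {i // ¬ p i} => y i)
  have := add_le_add h1 h2
  refine le_trans this (le_of_eq ?_)
  simp only [gN]; ring

lemma abs_le_gN {ι : Type*} [Fintype ι] (p : ι → Prop) [DecidablePred p] (x : ι → ℝ) (i : ι) : |x i| ≤ gN p x := by
  by_cases h : p i
  · have := norm_le_pi_norm (fun i : {i // p i} => x i) ⟨i, h⟩
    have h2 := norm_nonneg (fun i : {i // ¬ p i} => x i)
    simp only [Real.norm_eq_abs] at this
    simp only [gN]; linarith
  · have := norm_le_pi_norm (fun i : {i // ¬ p i} => x i) ⟨i, h⟩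
    have h2 := norm_nonneg (fun i : {i // p i} => x i)
    simp only [Real.norm_eq_abs] at this
    simp only [gN]; linarith

lemma gN_le {ι : Type*} [Fintype ι] (p : ι → Prop) [DecidablePred p] (x : ι → ℝ) (r s : ℝ) (hr : 0 ≤ r)
    (hs : 0 ≤ s) (h1 : ∀ i, p i → |x i| ≤ r) (h2 : ∀ i, ¬ p i → |x i| ≤ s) : gN p x ≤ r + s := by
  unfold gN
  gcongr
  · exact (pi_norm_le_iff_of_nonneg hr).2 fun i => h1 i i.2
  · exact (pi_norm_le_iff_of_nonneg hs).2 fun i => h2 i i.2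

lemma gN_eq_zero {ι : Type*} [Fintype ι] (p : ι → Prop) [DecidablePred p] {x : ι → ℝ} (h : gN p x = 0) : x = 0 := by
  funext i
  have := abs_le_gN p x i
  rw [h] at this
  exact abs_nonpos_iff.1 this

lemma gN_cont {ι : Type*} [Fintype ι] (p : ι → Prop) [DecidablePred p] : Continuous (gN p) := by
  unfold gN; fun_prop

lemma int_exp (κ : Type*) [Fintype κ] :
    ∫ x : κ → ℝ, Real.exp (-‖x‖) = 2 ^ Fintype.card κ * (Fintype.card κ).factorial := by
  have h := measure_unitBall_eq_integral_div_gamma (volume : Measure (κ → ℝ)) zero_lt_one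
  rw [Real.volume_pi_ball _ zero_lt_one] at h
  simp only [Real.rpow_one, div_one, Module.finrank_fintype_fun_eq_card,
    Real.Gamma_nat_eq_factorial, mul_one] at h
  have hi : 0 ≤ ∫ x : κ → ℝ, Real.exp (-‖x‖) := integral_nonneg fun _ => (Real.exp_pos _).le
  rw [ENNReal.ofReal_eq_ofReal_iff (by positivity) (by positivity)] at h
  rw [h]; field_simp

lemma vol_gN_lt {ι : Type*} [Fintype ι] (p : ι → Prop) [DecidablePred p] :
    volume {x : ι → ℝ | gN p x < 1} =
      ENNReal.ofReal (2 ^ Fintype.card ι / (Fintype.card ι).choose (Fintype.card {i // p i})) := by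
  rw [measure_lt_one_eq_integral_div_gamma volume (gN_zero p) (gN_neg p) (gN_add p)
    (gN_eq_zero p) (fun r x => (gN_smul p r x).le) zero_lt_one]
  simp only [Real.rpow_one, div_one, Module.finrank_fintype_fun_eq_card,
    Real.Gamma_nat_eq_factorial]
  congr 1
  have h := (volume_preserving_piEquivPiSubtypeProd (fun _ : ι => ℝ) p).integral_comp'
    (fun z => Real.exp (-‖z.1‖) * Real.exp (-‖z.2‖))
  have h2 : ∀ x : ι → ℝ, Real.exp (-gN p x) =
    Real.exp (-‖(MeasurableEquiv.piEquivPiSubtypeProd (fun _ : ι => ℝ) p x).1‖) *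
    Real.exp (-‖(MeasurableEquiv.piEquivPiSubtypeProd (fun _ : ι => ℝ) p x).2‖) := by
    intro x
    rw [← Real.exp_add, gN, neg_add]
    congr!
  simp_rw [h2]
  rw [h, Measure.volume_eq_prod, integral_prod_mul (fun x => Real.exp (-‖x‖))
    (fun x => Real.exp (-‖x‖)), int_exp, int_exp]
  have hc : Fintype.card {i // ¬ p i} = Fintype.card ι - Fintype.card {i // p i} :=
    Fintype.card_subtype_compl _
  have hle : Fintype.card {i // p i} ≤ Fintype.card ι := Fintype.card_subtype_le _
  rw [hc, Nat.cast_choose ℝ hle]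
  obtain ⟨e, he⟩ := Nat.exists_eq_add_of_le hle
  rw [he, Nat.add_sub_cancel_left, pow_add]
  field_simp

lemma vol_gN {ι : Type*} [Fintype ι] [Nonempty ι] (p : ι → Prop) [DecidablePred p]
    (r : ℝ) (hr : 0 < r) :
    volume {x : ι → ℝ | gN p x ≤ r} =
      ENNReal.ofReal (r ^ Fintype.card ι *
        (2 ^ Fintype.card ι / (Fintype.card ι).choose (Fintype.card {i // p i}))) := by
  have h1 : {x : ι → ℝ | gN p x ≤ r} = r • {x : ι → ℝ | gN p x ≤ 1} := by
    ext x
    rw [Set.mem_smul_set_iff_inv_smul_mem₀ hr.ne']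
    simp only [Set.mem_ofPred_eq, gN_smul, abs_inv, abs_of_pos hr]
    rw [inv_mul_le_iff₀ hr, mul_one]
  rw [h1, Measure.addHaar_smul_of_nonneg _ hr.le,
    measure_le_eq_lt volume (gN_zero p) (gN_neg p) (gN_add p)
    (gN_eq_zero p) (fun r x => (gN_smul p r x).le), vol_gN_lt, Module.finrank_fintype_fun_eq_card,
    ← ENNReal.ofReal_mul (by positivity)]

lemma vol_box {ι : Type*} [Fintype ι] (q : ι → Prop) [DecidablePred q] (r : ℝ) (hr : 0 ≤ r)
    (Y : Set ({i // ¬ q i} → ℝ)) :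
    volume {x : ι → ℝ | (∀ i, q i → |x i| ≤ r) ∧ (fun i : {i // ¬ q i} => x i) ∈ Y} =
      ENNReal.ofReal ((2 * r) ^ Fintype.card {i // q i}) * volume Y := by
  have h := (volume_preserving_piEquivPiSubtypeProd (fun _ : ι => ℝ) q).measure_preimage_equiv
    (Metric.closedBall 0 r ×ˢ Y)
  rw [Measure.volume_eq_prod, Measure.prod_prod, Real.volume_pi_closedBall _ hr] at h
  rw [← h]
  congr 1
  ext x
  simp only [Set.mem_ofPred_eq, Set.mem_preimage, Set.mem_prod, mem_closedBall_zero_iff,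
    pi_norm_le_iff_of_nonneg hr]
  constructor
  · rintro ⟨h1, h2⟩; exact ⟨fun i => h1 i i.2, h2⟩
  · rintro ⟨h1, h2⟩; exact ⟨fun i hi => h1 ⟨i, hi⟩, h2⟩

lemma exists_blocks (n m : ℕ) (hm : 1 ≤ m) (α : Fin m → ℕ) (hα : ∀ i, 1 ≤ α i ∧ α i ≤ n)
    (d : ℕ) (hd : ∑ i, α i = (m - 1) * n + d) :
    ∃ f : Fin n → Option (Fin m), Fintype.card {i // f i = none} = d ∧
      ∀ k, Fintype.card {i // f i = some k} = n - α k := by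
  have hs : ∑ k, (n - α k) + d = n := by
    have h1 : ∑ k, (n - α k) + ∑ k, α k = m * n := by
      rw [← Finset.sum_add_distrib, Finset.sum_congr rfl (fun k _ => Nat.sub_add_cancel (hα k).2)]
      simp
    obtain ⟨m, rfl⟩ : ∃ m', m = m' + 1 := ⟨m - 1, by omega⟩
    simp only [Nat.add_sub_cancel] at hd
    have : (m + 1) * n = m * n + n := by ring
    omega
  let β : Option (Fin m) → ℕ := fun o => o.elim d (fun k => n - α k)
  have hc : Fintype.card (Fin n) = Fintype.card (Σ o, Fin (β o)) := by
    simp [Fintype.sum_option, β]; omega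
  let e := Fintype.equivOfCardEq hc
  have key : ∀ o, Fintype.card {i // (e i).1 = o} = β o := by
    intro o
    rw [← Fintype.card_fin (β o)]
    refine Fintype.card_congr ?_
    refine (e.subtypeEquiv (q := fun s => s.1 = o) (fun a => Iff.rfl)).trans ?_
    exact Equiv.sigmaSubtype o
  exact ⟨fun i => (e i).1, key none, fun k => key (some k)⟩

lemma isConvexBody_of {n : ℕ} (S : Set (EuclideanSpace ℝ (Fin n))) (hc : Convex ℝ S)
    (hcl : IsClosed S) (R δ : ℝ) (hδ : 0 < δ) (hR : ∀ x ∈ S, ∀ i, |x i| ≤ R)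
    (hin : ∀ x : EuclideanSpace ℝ (Fin n), (∀ i, |x i| < δ) → x ∈ S) : IsConvexBody S := by
  refine ⟨hc, ?_, ?_⟩
  · have hK : IsCompact (Set.univ.pi fun _ : Fin n => Set.Icc (-R) R) :=
      isCompact_univ_pi fun _ => isCompact_Icc
    refine (hK.image (PiLp.continuous_toLp 2 (fun _ : Fin n => ℝ))).of_isClosed_subset hcl ?_
    intro x hx
    refine ⟨x.ofLp, ?_, rfl⟩
    intro i _
    exact abs_le.1 (hR x hx i)
  · refine ⟨0, mem_interior.2 ⟨{x | ∀ i, |x i| < δ}, fun x hx => hin x hx, ?_, ?_⟩⟩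
    · have : {x : EuclideanSpace ℝ (Fin n) | ∀ i, |x i| < δ} = ⋂ i, {x | |x i| < δ} := by
        ext x; simp
      rw [this]
      refine isOpen_iInter_of_finite fun i => isOpen_lt (by fun_prop) continuous_const
    · simpa using fun _ => hδ

lemma vol_ofLp {n : ℕ} (S : Set (Fin n → ℝ)) :
    volume {x : EuclideanSpace ℝ (Fin n) | x.ofLp ∈ S} = volume S :=
  (EuclideanSpace.volume_preserving_symm_measurableEquiv_toLp (Fin n)).measure_preimage_equiv S

lemma gN_restrict {ι : Type*} [Fintype ι] (p q : ι → Prop) [DecidablePred p] [DecidablePred q]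
    (x : ι → ℝ) :
    gN (fun i : {i // q i} => p i.1) (fun i => x i) ≤ gN p x := by
  refine gN_le _ _ _ _ (norm_nonneg _) (norm_nonneg _) ?_ ?_
  · intro i hi
    exact norm_le_pi_norm (fun i : {i // p i} => x i) ⟨i, hi⟩
  · intro i hi
    exact norm_le_pi_norm (fun i : {i // ¬ p i} => x i) ⟨i, hi⟩

/-- the body A -/
def bodyA {n m : ℕ} (f : Fin n → Option (Fin m)) : Set (EuclideanSpace ℝ (Fin n)) :=
  {x | gN (fun i => f i = none) x.ofLp ≤ 1}

/-- the boxes -/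
def bodyB {n m : ℕ} (f : Fin n → Option (Fin m)) (L ε : ℝ) (k : Fin m) :
    Set (EuclideanSpace ℝ (Fin n)) :=
  {x | ∀ i, |x i| ≤ if f i = some k then L else ε}

lemma bodyA_convexBody {n m : ℕ} (f : Fin n → Option (Fin m)) : IsConvexBody (bodyA f) := by
  refine isConvexBody_of _ ?_ ?_ 1 (1/2) (by norm_num) ?_ ?_
  · intro x hx y hy a b ha hb hab
    simp only [bodyA, Set.mem_ofPred_eq] at *
    rw [WithLp.ofLp_add, WithLp.ofLp_smul, WithLp.ofLp_smul]
    refine (gN_add _ _ _).trans ?_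
    rw [gN_smul, gN_smul, abs_of_nonneg ha, abs_of_nonneg hb]
    nlinarith
  · exact isClosed_le ((gN_cont _).comp (PiLp.continuous_ofLp 2 _)) continuous_const
  · intro x hx i
    exact (abs_le_gN (fun i => f i = none) x.ofLp i).trans hx
  · intro x hx
    have := gN_le (fun i => f i = none) x.ofLp (1/2) (1/2) (by norm_num) (by norm_num)
      (fun i _ => (hx i).le) (fun i _ => (hx i).le)
    simp only [bodyA, Set.mem_ofPred_eq]
    linarith

lemma bodyB_convexBody {n m : ℕ} (f : Fin n → Option (Fin m)) (L ε : ℝ) (hL : 0 < L) (hε : 0 < ε)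
    (k : Fin m) : IsConvexBody (bodyB f L ε k) := by
  refine isConvexBody_of _ ?_ ?_ (max L ε) (min L ε) (lt_min hL hε) ?_ ?_
  · intro x hx y hy a b ha hb hab i
    have h1 := hx i
    have h2 := hy i
    simp only [PiLp.add_apply, PiLp.smul_apply, smul_eq_mul]
    refine (abs_add_le _ _).trans ?_
    rw [abs_mul, abs_mul, abs_of_nonneg ha, abs_of_nonneg hb]
    have hb' : b = 1 - a := by linarith
    subst hb'
    nlinarith
  · have : bodyB f L ε k = ⋂ i, {x | |x i| ≤ if f i = some k then L else ε} := by
      ext x; simp [bodyB]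
    rw [this]
    exact isClosed_iInter fun i => isClosed_le (by fun_prop) continuous_const
  · intro x hx i
    refine (hx i).trans ?_
    split_ifs <;> simp
  · intro x hx i
    refine (hx i).le.trans ?_
    split_ifs <;> simp

lemma vol_upper {n m : ℕ} (f : Fin n → Option (Fin m)) (L ε : ℝ) (hL : 0 < L) (hε : 0 < ε)
    (k : Fin m) (d a : ℕ) (ha1 : 1 ≤ a) (han : a ≤ n)
    (hd : Fintype.card {i // f i = none} = d) (ha : Fintype.card {i // f i = some k} = n - a) :
    (volume (bodyA f + bodyB f L ε k)).toReal ≤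
      (2 * (L + 1)) ^ (n - a) * ((1 + 2 * ε) ^ a * (2 ^ a / (a.choose d : ℝ))) := by
  have hcard : Fintype.card {i // ¬ f i = some k} = a := by
    rw [Fintype.card_subtype_compl, ha, Fintype.card_fin]; omega
  have hne : Nonempty {i // ¬ f i = some k} := by
    rw [← Fintype.card_pos_iff]; omega
  have hcard2 : Fintype.card {i : {i // ¬ f i = some k} // f i.1 = none} = d := by
    rw [← hd]
    refine Fintype.card_congr (Equiv.subtypeSubtypeEquivSubtype
      (p := fun i => ¬ f i = some k) (q := fun i => f i = none) ?_)
    intro x hx; simp [hx]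
  have hsub : bodyA f + bodyB f L ε k ⊆ {x : EuclideanSpace ℝ (Fin n) | x.ofLp ∈
      {x : Fin n → ℝ | (∀ i, f i = some k → |x i| ≤ L + 1) ∧
        (fun i : {i // ¬ f i = some k} => x i) ∈
          {y | gN (fun i : {i // ¬ f i = some k} => f i.1 = none) y ≤ 1 + 2 * ε}}} := by
    rintro _ ⟨x, hx, y, hy, rfl⟩
    refine ⟨?_, ?_⟩
    · intro i hi
      have h1 := (abs_le_gN (fun i => f i = none) x.ofLp i).trans hx
      have h2 := hy i
      rw [if_pos hi] at h2
      exact (abs_add_le (x.ofLp i) (y.ofLp i)).trans (by linarith)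
    · have h1 := (gN_restrict (fun i => f i = none) (fun i => ¬ f i = some k) x.ofLp).trans hx
      have h2 : gN (fun i : {i // ¬ f i = some k} => f i.1 = none) (fun i => y.ofLp i) ≤ ε + ε := by
        refine gN_le _ _ _ _ hε.le hε.le ?_ ?_ <;>
        · intro i _
          have := hy i
          rwa [if_neg i.2] at this
      have h3 := gN_add (fun i : {i // ¬ f i = some k} => f i.1 = none) (fun i => x.ofLp i)
        (fun i => y.ofLp i)
      refine h3.trans ?_
      linarith
  have hv := measure_mono (μ := volume) hsub
  rw [vol_ofLp, vol_box _ _ (by linarith), vol_gN _ _ (by linarith), ha, hcard, hcard2,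
    ← ENNReal.ofReal_mul (by positivity)] at hv
  exact ENNReal.toReal_le_of_le_ofReal (by positivity) hv

lemma vol_lower {n m : ℕ} (f : Fin n → Option (Fin m)) (L ε : ℝ) (hL : 0 < L) (hε : 0 < ε)
    (d : ℕ) (hd : Fintype.card {i // f i = none} = d)
    (hfin : volume (bodyA f + ∑ k, bodyB f L ε k) ≠ ⊤) :
    2 ^ d * (2 * L) ^ (n - d) ≤ (volume (bodyA f + ∑ k, bodyB f L ε k)).toReal := by
  have hcard : Fintype.card {i // ¬ f i = none} = n - d := by
    rw [Fintype.card_subtype_compl, hd, Fintype.card_fin]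
  have hsub : {x : EuclideanSpace ℝ (Fin n) | x.ofLp ∈
      {x : Fin n → ℝ | (∀ i, f i = none → |x i| ≤ 1) ∧
        (fun i : {i // ¬ f i = none} => x i) ∈ Metric.closedBall 0 L}} ⊆
      bodyA f + ∑ k, bodyB f L ε k := by
    rintro x ⟨h1, h2⟩
    rw [mem_closedBall_zero_iff, pi_norm_le_iff_of_nonneg hL.le] at h2
    let y : EuclideanSpace ℝ (Fin n) := WithLp.toLp 2 fun i => if f i = none then x i else 0
    let z : Fin m → EuclideanSpace ℝ (Fin n) :=
      fun k => WithLp.toLp 2 fun i => if f i = some k then x i else 0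
    have hxy : x = y + ∑ k, z k := by
      ext i
      simp only [PiLp.add_apply, WithLp.ofLp_sum, Finset.sum_apply, y, z]
      rcases hfi : f i with _ | k <;> simp
    rw [hxy]
    refine Set.add_mem_add ?_ (Set.finsetSum_mem_finsetSum _ _ _ ?_)
    · have := gN_le (fun i => f i = none) y.ofLp 1 0 (by norm_num) (by norm_num)
        (fun i hi => by simpa [y, hi] using h1 i hi) (fun i hi => by simp [y, hi])
      simpa [bodyA] using this
    · intro k _ i
      by_cases hi : f i = some k
      · simpa [z, hi] using h2 ⟨i, by simp [hi]⟩
      · simpa [z, hi] using hε.le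
  have hv := measure_mono (μ := volume) hsub
  rw [vol_ofLp, vol_box _ _ (by norm_num), Real.volume_pi_closedBall _ hL.le, hd, hcard, mul_one,
    ← ENNReal.ofReal_mul (by positivity)] at hv
  exact (ENNReal.ofReal_le_iff_le_toReal hfin).1 hv

theorem bezout_constant_lower_bound_binomial (n m : ℕ) (hn : 1 ≤ n) (hm : 1 ≤ m)
    (α : Fin m → ℕ) (hα : ∀ i, 1 ≤ α i ∧ α i ≤ n)
    (d : ℕ) (hd0 : 0 < d) (hd : ∑ i, α i = (m - 1) * n + d)
    (c : ℝ) (hc : IsLeast {x : ℝ | BezoutConst n m x} c) :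
    c ≥ (∏ i, ((α i).choose d : ℝ)) / (n.choose d : ℝ) ^ (m - 1) := by
  have hB : BezoutConst n m c := hc.1
  obtain ⟨f, hf0, hf⟩ := exists_blocks n m hm α hα d hd
  have hdn : d ≤ n := by
    have := Fintype.card_subtype_le (fun i => f i = none)
    rw [Fintype.card_fin] at this; omega
  have hdα : ∀ k, d ≤ α k := by
    intro k
    have h1 : Fintype.card {i // ¬ f i = some k} = α k := by
      rw [Fintype.card_subtype_compl, hf, Fintype.card_fin]; have := hα k; omega
    rw [← h1, ← hf0]
    exact Fintype.card_subtype_mono _ _ (fun i hi => by simp [hi])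
  have hsum : ∑ k, (n - α k) = n - d := by
    have h1 : ∑ k, (n - α k) + ∑ k, α k = m * n := by
      rw [← Finset.sum_add_distrib, Finset.sum_congr rfl (fun k _ => Nat.sub_add_cancel (hα k).2)]
      simp
    obtain ⟨m, rfl⟩ : ∃ m', m = m' + 1 := ⟨m - 1, by omega⟩
    simp only [Nat.add_sub_cancel] at hd
    have : (m + 1) * n = m * n + n := by ring
    omega
  have hCn : (0 : ℝ) < n.choose d := by exact_mod_cast Nat.choose_pos hdn
  have hCα : ∀ k, (0 : ℝ) < (α k).choose d := fun k => by exact_mod_cast Nat.choose_pos (hdα k)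
  have hvA : (volume (bodyA f)).toReal = 2 ^ n / (n.choose d : ℝ) := by
    have : Nonempty (Fin n) := ⟨⟨0, hn⟩⟩
    have h := vol_gN (fun i => f i = none) 1 one_pos
    rw [Fintype.card_fin, hf0, one_pow, one_mul] at h
    have h2 := vol_ofLp {x : Fin n → ℝ | gN (fun i => f i = none) x ≤ 1}
    rw [h] at h2
    have h3 : volume (bodyA f) = ENNReal.ofReal (2 ^ n / (n.choose d : ℝ)) := h2
    rw [h3, ENNReal.toReal_ofReal (by positivity)]
  -- the inequality for all scales
  have key : ∀ L ε : ℝ, 0 < L → 0 < ε →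
      (2 ^ n / (n.choose d : ℝ)) ^ (m - 1) * (2 ^ d * (2 * L) ^ (n - d)) ≤
      c * ∏ k, ((2 * (L + 1)) ^ (n - α k) *
        ((1 + 2 * ε) ^ (α k) * (2 ^ (α k) / ((α k).choose d : ℝ)))) := by
    intro L ε hL hε
    have h := hB (bodyA f) (bodyB f L ε) (bodyA_convexBody f) (bodyB_convexBody f L ε hL hε)
    have hcomp : IsCompact (bodyA f + ∑ k, bodyB f L ε k) := by
      refine (bodyA_convexBody f).2.1.add ?_
      refine Finset.sum_induction _ IsCompact (fun a b ha hb => ha.add hb) isCompact_singleton ?_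
      intro k _
      exact (bodyB_convexBody f L ε hL hε k).2.1
    have hlow := vol_lower f L ε hL hε d hf0 hcomp.measure_lt_top.ne
    rw [hvA] at h
    have h1 : (2 ^ n / (n.choose d : ℝ)) ^ (m - 1) * (2 ^ d * (2 * L) ^ (n - d)) ≤
        c * ∏ k, (volume (bodyA f + bodyB f L ε k)).toReal :=
      (mul_le_mul_of_nonneg_left hlow (by positivity)).trans h
    have hc0 : 0 ≤ c := by
      by_contra hneg
      have hp : 0 ≤ ∏ k, (volume (bodyA f + bodyB f L ε k)).toReal :=
        Finset.prod_nonneg fun _ _ => ENNReal.toReal_nonneg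
      have hpos : 0 < (2 ^ n / (n.choose d : ℝ)) ^ (m - 1) * (2 ^ d * (2 * L) ^ (n - d)) := by
        positivity
      nlinarith
    refine h1.trans (mul_le_mul_of_nonneg_left ?_ hc0)
    refine Finset.prod_le_prod (fun _ _ => ENNReal.toReal_nonneg) fun k _ => ?_
    exact vol_upper f L ε hL hε k d (α k) (hα k).1 (hα k).2 hf0 (hf k)
  -- rescaling
  have key2 : ∀ u : ℝ, 0 < u →
      (2 ^ n / (n.choose d : ℝ)) ^ (m - 1) * 2 ^ n ≤
      c * ∏ k, ((2 * (1 + u)) ^ (n - α k) *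
        ((1 + 2 * u) ^ (α k) * (2 ^ (α k) / ((α k).choose d : ℝ)))) := by
    intro u hu
    have h := mul_le_mul_of_nonneg_left (key u⁻¹ u (by positivity) hu)
      (pow_nonneg hu.le (n - d))
    have e1 : u ^ (n - d) * ((2 ^ n / (n.choose d : ℝ)) ^ (m - 1) * (2 ^ d * (2 * u⁻¹) ^ (n - d)))
        = (2 ^ n / (n.choose d : ℝ)) ^ (m - 1) * 2 ^ n := by
      have : (2 : ℝ) ^ n = 2 ^ d * (u * (2 * u⁻¹)) ^ (n - d) := by
        rw [show u * (2 * u⁻¹) = 2 by field_simp, ← pow_add]; congr 1; omega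
      rw [mul_pow] at this
      generalize ((2 : ℝ) ^ n / (n.choose d : ℝ)) ^ (m - 1) = X
      rw [this]; ring
    have e2 : u ^ (n - d) * (c * ∏ k, ((2 * (u⁻¹ + 1)) ^ (n - α k) *
        ((1 + 2 * u) ^ (α k) * (2 ^ (α k) / ((α k).choose d : ℝ))))) =
        c * ∏ k, ((2 * (1 + u)) ^ (n - α k) *
        ((1 + 2 * u) ^ (α k) * (2 ^ (α k) / ((α k).choose d : ℝ)))) := by
      rw [← hsum, ← Finset.prod_pow_eq_pow_sum, mul_left_comm, ← Finset.prod_mul_distrib]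
      congr 1
      refine Finset.prod_congr rfl fun k _ => ?_
      rw [← mul_assoc, ← mul_pow]
      congr 2
      field_simp
    rwa [e1, e2] at h
  have hcont : Continuous fun u : ℝ => c * ∏ k, ((2 * (1 + u)) ^ (n - α k) *
        ((1 + 2 * u) ^ (α k) * (2 ^ (α k) / ((α k).choose d : ℝ)))) := by fun_prop
  have hlim := (hcont.tendsto 0).mono_left (nhdsWithin_le_nhds (s := Set.Ioi 0))
  have hfinal := ge_of_tendsto hlim (Filter.eventually_of_mem self_mem_nhdsWithin key2)
  have e3 : ∏ k, ((2 * (1 + (0 : ℝ))) ^ (n - α k) *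
        ((1 + 2 * (0 : ℝ)) ^ (α k) * (2 ^ (α k) / ((α k).choose d : ℝ)))) =
        (2 ^ n) ^ m / ∏ k, ((α k).choose d : ℝ) := by
    have : ∀ k ∈ Finset.univ, ((2 * (1 + (0 : ℝ))) ^ (n - α k) *
        ((1 + 2 * (0 : ℝ)) ^ (α k) * (2 ^ (α k) / ((α k).choose d : ℝ)))) =
        2 ^ n / ((α k).choose d : ℝ) := by
      intro k _
      have : (2 : ℝ) ^ n = 2 ^ (n - α k) * 2 ^ (α k) := by
        rw [← pow_add]; congr 1; have := hα k; omega
      rw [this]; simp; ring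
    rw [Finset.prod_congr rfl this, Finset.prod_div_distrib]
    simp
  rw [e3] at hfinal
  have hP : (0 : ℝ) < ∏ k, ((α k).choose d : ℝ) := Finset.prod_pos fun k _ => hCα k
  have e4 : ((2 : ℝ) ^ n) ^ m = (2 ^ n) ^ (m - 1) * 2 ^ n := by
    rw [← pow_succ]; congr 1; omega
  rw [e4, div_pow] at hfinal
  have hT : (0 : ℝ) < (2 ^ n) ^ (m - 1) * 2 ^ n := by positivity
  rw [ge_iff_le, div_le_iff₀ (by positivity)]
  rw [div_mul_eq_mul_div, mul_div_assoc', div_le_div_iff₀ (by positivity) hP] at hfinal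
  refine le_of_mul_le_mul_left ?_ hT
  linarith
end
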